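/- arXiv:0905.1190 — 12 statements merged into one kernel-verified Lean document; each statement's English description precedes it below -/
import Mathlib

section
/- Let n ≥ 1 and let a be an integer with 0 < a < 2n, gcd(a,2n) = 1 and a² ≡ 1 (mod 2n). Let ε ∈ ℂ be a primitive 2n-th root of unity, α = [[ε,0],[0,ε^a]], β = [[0,1],[-1,0]] ∈ GL(2,ℂ). Then the subgroup of GL(2,ℂ) generated by α and β has exactly 4n elements. -/
namespace Subgroup

/-- If `b ∉ H` normalizes `H` and `b * b ∈ H`, then adjoining `b` to `H` doubles its order. -/
theorem card_closure_insert_eq_two_mul {G : Type*} [Group G] (H : Subgroup G) (b : G)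
    (hconj : ∀ h ∈ H, b * h * b⁻¹ ∈ H) (hsq : b * b ∈ H) (hb : b ∉ H) :
    Nat.card (closure (insert b (H : Set G))) = 2 * Nat.card H := by
  have hle : H ≤ closure (insert b (H : Set G)) := fun h hh => subset_closure (Or.inr hh)
  have hbmem : b ∈ closure (insert b (H : Set G)) := subset_closure (Or.inl rfl)
  have hconj' : ∀ h ∈ H, b⁻¹ * h * b ∈ H := fun h hh => by
    have := H.mul_mem (H.mul_mem (H.inv_mem hsq) (hconj h hh)) hsq
    convert this using 1
    group
  have hcases : ∀ g ∈ closure (insert b (H : Set G)), g ∈ H ∨ g * b ∈ H := fun g hg => by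
    induction hg using closure_induction with
    | mem x hx =>
      rcases hx with rfl | hx
      · exact Or.inr hsq
      · exact Or.inl hx
    | one => exact Or.inl H.one_mem
    | mul x y _ _ hx hy =>
      rcases hx with hx | hx <;> rcases hy with hy | hy
      · exact Or.inl (H.mul_mem hx hy)
      · exact Or.inr (by simpa [mul_assoc] using H.mul_mem hx hy)
      · refine Or.inr ?_
        have := H.mul_mem hx (hconj' y hy)
        convert this using 1
        group
      · refine Or.inl ?_
        have := H.mul_mem (H.mul_mem hx (hconj' _ hy)) (H.inv_mem hsq)
        convert this using 1
        group
    | inv x _ hx =>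
      rcases hx with hx | hx
      · exact Or.inl (H.inv_mem hx)
      · refine Or.inr ?_
        have := H.mul_mem (hconj _ (H.inv_mem hx)) hsq
        convert this using 1
        group
  have hindex : H.relIndex (closure (insert b (H : Set G))) = 2 := by
    rw [relIndex_eq_two_iff]
    refine ⟨b, hbmem, fun g hg => ?_⟩
    rcases hcases g hg with h | h
    · exact Or.inr ⟨h, fun h' => hb ((H.mul_mem_cancel_left h).1 h')⟩
    · exact Or.inl ⟨h, fun h' => hb ((H.mul_mem_cancel_left h').1 h)⟩
  have hcard := relIndex_mul_relIndex ⊥ H _ bot_le hle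
  rw [relIndex_bot_left, relIndex_bot_left, hindex] at hcard
  rw [← hcard, mul_comm]

end Subgroup

open Matrix

/-- The binary dihedral group `BD_{2n}(a) ⊂ GL(2,ℂ)` generated by `α = diag(ε, ε^a)` and
`β = [[0,1],[-1,0]]` has exactly `4n` elements. -/
theorem stmt_1 (n a : ℕ) (hn : 1 ≤ n) (ha0 : 0 < a) (ha : a < 2 * n)
    (hgcd : Nat.gcd a (2 * n) = 1) (hsq : a ^ 2 ≡ 1 [MOD 2 * n])
    (ε : ℂ) (hε : IsPrimitiveRoot ε (2 * n))
    (A B : GL (Fin 2) ℂ)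
    (hA : (A : Matrix (Fin 2) (Fin 2) ℂ) = !![ε, 0; 0, ε ^ a])
    (hB : (B : Matrix (Fin 2) (Fin 2) ℂ) = !![0, 1; -1, 0]) :
    Nat.card (Subgroup.closure ({A, B} : Set (GL (Fin 2) ℂ))) = 4 * n := by
  have hpow (k : ℕ) : ((A ^ k : GL (Fin 2) ℂ) : Matrix (Fin 2) (Fin 2) ℂ) =
      !![ε ^ k, 0; 0, (ε ^ a) ^ k] := by
    induction k with
    | zero => simp [Matrix.one_fin_two]
    | succ k ih => rw [pow_succ, Units.val_mul, ih, hA]; simp [pow_succ]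
  have horder : orderOf A = 2 * n := by
    refine Nat.dvd_antisymm (orderOf_dvd_of_pow_eq_one (Units.ext ?_)) (hε.dvd_of_pow_eq_one _ ?_)
    · rw [hpow, pow_right_comm, hε.pow_eq_one]
      simp [Matrix.one_fin_two]
    · have h := hpow (orderOf A)
      rw [pow_orderOf_eq_one] at h
      simpa using (congrFun₂ h 0 0).symm
  have hεn : ε ^ n = -1 := by
    have : IsPrimitiveRoot (ε ^ n) 2 := hε.pow (by omega) (mul_comm 2 n)
    exact this.eq_neg_one_of_two_right
  have hodd : Odd a := Nat.Coprime.odd_of_right (Nat.Coprime.coprime_mul_right_right hgcd)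
  have hεa : ε ^ (a * a) = ε := by
    rw [← pow_mod_orderOf, ← hε.eq_orderOf, ← sq, hsq, hε.eq_orderOf, pow_mod_orderOf, pow_one]
  have hBA : B * A * B⁻¹ = A ^ a := by
    rw [mul_inv_eq_iff_eq_mul]
    refine Units.ext ?_
    rw [Units.val_mul, Units.val_mul, hpow, hA, hB, ← pow_mul, hεa]
    simp
  have hBB : B * B = A ^ n := by
    refine Units.ext ?_
    rw [Units.val_mul, hpow, hB, ← pow_mul, mul_comm a, pow_mul, hεn, hodd.neg_one_pow]
    simp
  have hconj : ∀ g ∈ Subgroup.zpowers A, B * g * B⁻¹ ∈ Subgroup.zpowers A := by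
    rintro _ ⟨k, rfl⟩
    change B * A ^ k * B⁻¹ ∈ _
    rw [← conj_zpow, hBA]
    exact zpow_mem (Subgroup.npow_mem_zpowers A a) k
  have hfin : IsOfFinOrder A := orderOf_pos_iff.1 (by omega)
  have hnot : B ∉ Subgroup.zpowers A := by
    rw [← hfin.mem_powers_iff_mem_zpowers]
    rintro ⟨k, hk⟩
    have h : ((A ^ k : GL (Fin 2) ℂ) : Matrix (Fin 2) (Fin 2) ℂ) = !![0, 1; -1, 0] := by
      rw [← hB]; exact congrArg Units.val hk
    rw [hpow] at h
    simpa using congrFun₂ h 0 1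
  have hclosure : Subgroup.closure ({A, B} : Set (GL (Fin 2) ℂ)) =
      Subgroup.closure (insert B (Subgroup.zpowers A : Set (GL (Fin 2) ℂ))) := by
    rw [Set.pair_comm, Set.insert_eq, Set.insert_eq, Subgroup.closure_union, Subgroup.closure_union,
      Subgroup.closure_eq, Subgroup.zpowers_eq_closure]
  rw [hclosure, Subgroup.card_closure_insert_eq_two_mul _ B hconj
    (hBB ▸ Subgroup.npow_mem_zpowers A n) hnot, Nat.card_zpowers, horder]
  ring
end

section
/- Let n ≥ 1 and let a be an integer with 0 < a < 2n, gcd(a,2n) = 1 and a² ≡ 1 (mod 2n). Let ε ∈ ℂ be a primitive 2n-th root of unity, α = [[ε,0],[0,ε^a]], β = [[0,1],[-1,0]] ∈ GL(2,ℂ), and let G = BD_{2n}(a) be the subgroup of GL(2,ℂ) generated by α and β. Then G is small (contains no quasireflection) if and only if gcd(a+1, 2n) does not divide n. -/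
open Matrix

/-- If `B * A = A ^ a * B` and `B ^ 2` is a power of `A`, every element of the group generated by
`A` and `B` has the form `A ^ i` or `A ^ i * B`. -/
theorem exists_zpow_of_mem_closure_pair {G : Type*} [Group G] {A B : G} {a n : ℕ}
    (hBA : B * A = A ^ a * B) (hBB : B * B = A ^ n) {g : G}
    (hg : g ∈ Subgroup.closure ({A, B} : Set G)) :
    ∃ i : ℤ, g = A ^ i ∨ g = A ^ i * B := by
  have hcomm (i : ℤ) : B * A ^ i = A ^ (a * i) * B := by
    have h : SemiconjBy B A (A ^ a) := hBA
    have := (h.zpow_right i).eq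
    rwa [← zpow_natCast, ← _root_.zpow_mul] at this
  have hBB' : B * B = A ^ (n : ℤ) := by rw [hBB, zpow_natCast]
  induction hg using Subgroup.closure_induction with
  | mem x hx =>
    rcases hx with rfl | rfl
    · exact ⟨1, .inl (zpow_one _).symm⟩
    · exact ⟨0, .inr (by simp)⟩
  | one => exact ⟨0, .inl (zpow_zero _).symm⟩
  | mul x y _ _ hx hy =>
    obtain ⟨i, rfl | rfl⟩ := hx <;> obtain ⟨j, rfl | rfl⟩ := hy
    · exact ⟨i + j, .inl (_root_.zpow_add _ _ _).symm⟩
    · exact ⟨i + j, .inr (by rw [_root_.zpow_add, mul_assoc])⟩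
    · exact ⟨i + a * j, .inr (by rw [mul_assoc, hcomm, _root_.zpow_add, mul_assoc])⟩
    · refine ⟨i + a * j + n, .inl ?_⟩
      rw [mul_assoc, ← mul_assoc B, hcomm, mul_assoc _ B B, hBB', _root_.zpow_add, _root_.zpow_add, mul_assoc]
  | inv x _ hx =>
    obtain ⟨i, rfl | rfl⟩ := hx
    · exact ⟨-i, .inl (_root_.zpow_neg _ _).symm⟩
    · refine ⟨-n + a * -i, .inr ?_⟩
      have hBinv : B⁻¹ = A ^ (-n : ℤ) * B := by
        rw [_root_.zpow_neg, ← hBB', _root_.mul_inv_rev, mul_assoc, inv_mul_cancel, mul_one]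
      rw [_root_.mul_inv_rev, hBinv, ← _root_.zpow_neg, mul_assoc, hcomm, _root_.zpow_add, mul_assoc]

/-- A linear congruence `b * k ≡ n` modulo `2 * n` is solvable iff `gcd b (2 * n)` divides `n`. -/
theorem exists_mul_modEq_iff_gcd_dvd {b n : ℕ} (hn : 1 ≤ n) :
    (∃ k, b * k ≡ n [MOD 2 * n]) ↔ Nat.gcd b (2 * n) ∣ n := by
  constructor
  · rintro ⟨k, hk⟩
    exact ((hk.of_dvd (Nat.gcd_dvd_right b (2 * n))).dvd_iff dvd_rfl).1
      ((Nat.gcd_dvd_left _ _).mul_right k)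
  · intro h
    have hlt : Nat.gcd b (2 * n) < 2 * n := by
      have := Nat.le_of_dvd hn h
      omega
    obtain ⟨m, -, hm⟩ := Nat.exists_mul_mod_eq_gcd hlt
    obtain ⟨c, hc⟩ := h
    refine ⟨m * c, ?_⟩
    have h1 : b * m ≡ Nat.gcd b (2 * n) [MOD 2 * n] := by
      rw [Nat.ModEq, hm, Nat.mod_eq_of_lt hlt]
    have h2 := h1.mul_right c
    rwa [← hc, mul_assoc] at h2

/-- `BD_{2n}(a)` is small (contains no quasireflection) iff `gcd(a+1, 2n)` does not
divide `n`. -/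
theorem stmt_3 (n a : ℕ) (hn : 1 ≤ n) (ha0 : 0 < a) (ha : a < 2 * n)
    (hgcd : Nat.gcd a (2 * n) = 1) (hsq : a ^ 2 ≡ 1 [MOD 2 * n])
    (ε : ℂ) (hε : IsPrimitiveRoot ε (2 * n))
    (A B : GL (Fin 2) ℂ)
    (hA : (A : Matrix (Fin 2) (Fin 2) ℂ) = !![ε, 0; 0, ε ^ a])
    (hB : (B : Matrix (Fin 2) (Fin 2) ℂ) = !![0, 1; -1, 0]) :
    (∀ g ∈ Subgroup.closure ({A, B} : Set (GL (Fin 2) ℂ)), g ≠ 1 →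
        Matrix.det ((g : Matrix (Fin 2) (Fin 2) ℂ) - 1) ≠ 0) ↔
      ¬ (Nat.gcd (a + 1) (2 * n) ∣ n) := by
  have hmod (r s : ℕ) : ε ^ r = ε ^ s ↔ r ≡ s [MOD 2 * n] := by
    obtain ⟨u, rfl⟩ := hε.isUnit (by omega)
    rw [← Units.val_pow_eq_pow_val, ← Units.val_pow_eq_pow_val, Units.val_inj,
      pow_eq_pow_iff_modEq, (IsPrimitiveRoot.coe_units_iff.1 hε).eq_orderOf]
  have hεn : ε ^ n = -1 := (hε.pow (by omega) (mul_comm 2 n)).eq_neg_one_of_two_right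
  have hodd : Odd a := (Nat.Coprime.coprime_mul_right_right hgcd).odd_of_right
  have hεaa : (ε ^ a) ^ a = ε := by
    rw [← pow_mul, ← sq]
    simpa using (hmod _ _).2 hsq
  have hpow (k : ℕ) : ((A ^ k : GL (Fin 2) ℂ) : Matrix (Fin 2) (Fin 2) ℂ) =
      !![ε ^ k, 0; 0, (ε ^ a) ^ k] := by
    rw [Units.val_pow_eq_pow_val, hA]
    induction k with
    | zero => simp [one_fin_two]
    | succ k ih => simp [pow_succ, ih]
  have hBA : B * A = A ^ a * B := by
    ext1
    rw [Units.val_mul, Units.val_mul, hpow, hA, hB, hεaa]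
    simp
  have hBB : B * B = A ^ n := by
    ext1
    rw [Units.val_mul, hpow, hB, pow_right_comm, hεn, hodd.neg_one_pow]
    simp
  have hfin : IsOfFinOrder A := by
    refine isOfFinOrder_iff_pow_eq_one.2 ⟨2 * n, by omega, ?_⟩
    ext1
    rw [hpow, pow_right_comm, hε.pow_eq_one, one_pow, Units.val_one, one_fin_two]
  have hpowB (k : ℕ) : ((A ^ k * B : GL (Fin 2) ℂ) : Matrix (Fin 2) (Fin 2) ℂ) =
      !![0, ε ^ k; -(ε ^ a) ^ k, 0] := by
    rw [Units.val_mul, hpow, hB]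
    simp
  have hdetB (k : ℕ) : ((A ^ k * B : GL (Fin 2) ℂ) - 1 : Matrix (Fin 2) (Fin 2) ℂ).det = 0 ↔
      (a + 1) * k ≡ n [MOD 2 * n] := by
    rw [← hmod, hεn, hpowB, one_fin_two, eq_neg_iff_add_eq_zero, pow_mul]
    simp [det_fin_two]
    ring_nf
  rw [← exists_mul_modEq_iff_gcd_dvd hn, not_exists]
  constructor
  · intro h k hk
    refine h (A ^ k * B) (mul_mem (pow_mem (Subgroup.subset_closure (by simp)) k)
      (Subgroup.subset_closure (by simp))) (fun h1 => ?_) ((hdetB k).2 hk)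
    have := congrArg (fun g : GL (Fin 2) ℂ => (g : Matrix (Fin 2) (Fin 2) ℂ) 0 0) h1
    simp only [hpowB] at this
    simp at this
  · intro h g hg hg1 hdet
    obtain ⟨i, hi⟩ := exists_zpow_of_mem_closure_pair hBA hBB hg
    obtain ⟨k, hk : A ^ k = A ^ i⟩ := hfin.mem_powers_iff_mem_zpowers.2 ⟨i, rfl⟩
    rw [← hk] at hi
    rcases hi with rfl | rfl
    · have hεk : ε ^ k = 1 := by
        rw [hpow, one_fin_two] at hdet
        simp [det_fin_two, sub_eq_zero] at hdet
        rcases hdet with h1 | h1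
        · exact h1
        · rw [← hεaa, pow_right_comm, h1, one_pow]
      refine hg1 ?_
      ext1
      rw [hpow, pow_right_comm, hεk, one_pow, Units.val_one, one_fin_two]
    · exact h k ((hdetB k).1 hdet)
end

section
/- Let n ≥ 1 and let a be an integer with 0 < a < 2n and a² ≡ 1 (mod 2n). Then the Hirzebruch–Jung continued fraction expansion 2n/a = [b₁, b₂, …, b_ℓ] is palindromic: b_i = b_{ℓ+1−i} for every 1 ≤ i ≤ ℓ. -/
/-- The denominators of the convergents of the Hirzebruch–Jung continued fraction with
partial quotients `b 1, b 2, …`. -/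
def hjDenom (b : ℕ → ℤ) : ℕ → ℤ
  | 0 => 0
  | 1 => 1
  | i + 2 => b (i + 1) * hjDenom b (i + 1) - hjDenom b i

theorem hjDenom_succ (b : ℕ → ℤ) {i : ℕ} (hi : 1 ≤ i) :
    hjDenom b (i + 1) = b i * hjDenom b i - hjDenom b (i - 1) := by
  obtain ⟨j, rfl⟩ := Nat.exists_eq_add_of_le' hi
  rw [hjDenom, Nat.add_sub_cancel]

/-- The sequence of denominators is nonnegative and strictly increasing when the partial
quotients are at least `2`. -/
theorem hjDenom_nonneg_lt {b : ℕ → ℤ} {l : ℕ} (hb : ∀ i, 1 ≤ i → i ≤ l → 2 ≤ b i)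
    {i : ℕ} (hi : i ≤ l) : 0 ≤ hjDenom b i ∧ hjDenom b i < hjDenom b (i + 1) := by
  induction i with
  | zero => simp [hjDenom]
  | succ i ih =>
    obtain ⟨h0, h1⟩ := ih (by omega)
    have h2 := hb (i + 1) (by omega) hi
    rw [hjDenom]
    exact ⟨by omega, by nlinarith⟩

/-- The determinant identity between remainders and denominators. -/
theorem mul_hjDenom_sub {b r : ℕ → ℤ} {l : ℕ}
    (hrec : ∀ i, 1 ≤ i → i ≤ l → r (i + 1) = b i * r i - r (i - 1)) {i : ℕ} (hi : i ≤ l) :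
    r i * hjDenom b (i + 1) - r (i + 1) * hjDenom b i = r 0 := by
  induction i with
  | zero => simp [hjDenom]
  | succ i ih =>
    have h := hrec (i + 1) (by omega) hi
    rw [Nat.add_sub_cancel] at h
    rw [hjDenom, h, ← ih (by omega)]
    ring

/-- Modulo `r 0`, the remainders are `r 1` times the denominators. -/
theorem dvd_mul_hjDenom_sub {b r : ℕ → ℤ} {l : ℕ}
    (hrec : ∀ i, 1 ≤ i → i ≤ l → r (i + 1) = b i * r i - r (i - 1)) {i : ℕ} (hi : i ≤ l) :
    r 0 ∣ r 1 * hjDenom b i - r i ∧ r 0 ∣ r 1 * hjDenom b (i + 1) - r (i + 1) := by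
  induction i with
  | zero => simp [hjDenom]
  | succ i ih =>
    obtain ⟨h0, h1⟩ := ih (by omega)
    have h := hrec (i + 1) (by omega) hi
    rw [Nat.add_sub_cancel] at h
    refine ⟨h1, ?_⟩
    rw [hjDenom, h]
    have h2 := dvd_sub (h1.mul_left (b (i + 1))) h0
    ring_nf at h2 ⊢
    exact h2

/-- Uniqueness of the quotient and remainder in one step of the expansion. -/
theorem hj_step_unique {b c x y z w : ℤ} (hz : z = b * y - x) (hw : w = c * y - x)
    (hz0 : 0 ≤ z) (hzy : z < y) (hw0 : 0 ≤ w) (hwy : w < y) : b = c ∧ z = w := by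
  have h : b = c := by
    apply le_antisymm <;> by_contra! h <;> nlinarith
  exact ⟨h, by rw [hz, hw, h]⟩

/-- Two remainder sequences with the same first two terms have the same partial quotients. -/
theorem hj_expansion_unique {b c r t : ℕ → ℤ} {l : ℕ}
    (hr : ∀ i, 1 ≤ i → i ≤ l → r (i + 1) = b i * r i - r (i - 1))
    (ht : ∀ i, 1 ≤ i → i ≤ l → t (i + 1) = c i * t i - t (i - 1))
    (hr' : ∀ i, 1 ≤ i → i ≤ l → 0 ≤ r (i + 1) ∧ r (i + 1) < r i)
    (ht' : ∀ i, 1 ≤ i → i ≤ l → 0 ≤ t (i + 1) ∧ t (i + 1) < t i)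
    (h0 : r 0 = t 0) (h1 : r 1 = t 1) {i : ℕ} (hi : 1 ≤ i) (hil : i ≤ l) : b i = c i := by
  have step : ∀ i, 1 ≤ i → i ≤ l → r (i - 1) = t (i - 1) → r i = t i →
      b i = c i ∧ r (i + 1) = t (i + 1) := by
    intro i hi hil h h'
    have hti := ht i hi hil
    have hti' := ht' i hi hil
    rw [← h, ← h'] at hti
    rw [← h'] at hti'
    exact hj_step_unique (hr i hi hil) hti (hr' i hi hil).1 (hr' i hi hil).2 hti'.1 hti'.2
  have agree : ∀ i, i ≤ l → r i = t i ∧ r (i + 1) = t (i + 1) := by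
    intro i hil
    induction i with
    | zero => exact ⟨h0, h1⟩
    | succ i ih =>
      obtain ⟨h, h'⟩ := ih (by omega)
      exact ⟨h', (step (i + 1) (by omega) hil h h').2⟩
  have h := agree (i - 1) (by omega)
  rw [Nat.sub_add_cancel hi] at h
  exact (step i hi hil h.1 h.2).1

/-- If `a² ≡ 1 (mod 2n)`, the Hirzebruch–Jung continued fraction expansion
`2n/a = [b₁, …, b_ℓ]` is palindromic: `b i = b (ℓ+1−i)` for all `1 ≤ i ≤ ℓ`.
The expansion is encoded by the remainder sequence `r` with `r 0 = 2n`, `r 1 = a`,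
`r (i+1) = b i * r i − r (i−1)` with `0 ≤ r (i+1) < r i` (so `b i = ⌈r (i−1) / r i⌉`),
all `r i > 0` for `1 ≤ i ≤ ℓ`, and `r (ℓ+1) = 0`. -/
theorem stmt_4 (n : ℕ) (hn : 1 ≤ n) (a : ℕ) (ha0 : 0 < a) (ha : a < 2 * n)
    (hsq : a ^ 2 ≡ 1 [MOD 2 * n])
    (ℓ : ℕ) (hℓ : 1 ≤ ℓ) (b : ℕ → ℤ) (r : ℕ → ℤ)
    (hr0 : r 0 = 2 * n) (hr1 : r 1 = a)
    (hrec : ∀ i, 1 ≤ i → i ≤ ℓ → r (i + 1) = b i * r i - r (i - 1))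
    (hpos : ∀ i, 1 ≤ i → i ≤ ℓ → 0 < r i)
    (hnonneg : ∀ i, 1 ≤ i → i ≤ ℓ → 0 ≤ r (i + 1))
    (hlt : ∀ i, 1 ≤ i → i ≤ ℓ → r (i + 1) < r i)
    (hend : r (ℓ + 1) = 0) :
    ∀ i, 1 ≤ i → i ≤ ℓ → b i = b (ℓ + 1 - i) := by
  have hdesc : ∀ i, 1 ≤ i → i ≤ ℓ → r i < r (i - 1) := by
    intro i hi hil
    rcases hi.eq_or_lt with rfl | hi'
    · rw [Nat.sub_self, hr0, hr1]
      exact_mod_cast ha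
    · simpa [Nat.sub_add_cancel hi] using hlt (i - 1) (by omega) (by omega)
  have hb : ∀ i, 1 ≤ i → i ≤ ℓ → 2 ≤ b i := by
    intro i hi hil
    have h := hrec i hi hil
    have h0 := hnonneg i hi hil
    have h1 := hdesc i hi hil
    have h2 := hpos i hi hil
    by_contra! h3
    nlinarith
  have hk : 0 < r 0 := by omega
  have hmono := fun i (hi : i ≤ ℓ) => hjDenom_nonneg_lt hb hi
  have hcop : IsCoprime (r 0) (r 1) := by
    obtain ⟨m, hm⟩ := Int.modEq_iff_dvd.mp (Int.natCast_modEq_iff.mpr hsq)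
    refine ⟨m, r 1, ?_⟩
    rw [hr0, hr1]
    push_cast at hm
    linear_combination -hm
  have hdiv := dvd_mul_hjDenom_sub hrec le_rfl
  have hdet : r ℓ * hjDenom b (ℓ + 1) = r 0 := by
    simpa [hend] using mul_hjDenom_sub hrec le_rfl
  have hlast : hjDenom b (ℓ + 1) = r 0 := by
    have h : r 0 ∣ hjDenom b (ℓ + 1) := by
      refine hcop.dvd_of_dvd_mul_left ?_
      simpa [hend] using hdiv.2
    have hs := hmono ℓ le_rfl
    exact Int.dvd_antisymm (by omega) hk.le ⟨r ℓ, by rw [← hdet, mul_comm]⟩ h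
  have hrl : r ℓ = 1 := by
    rw [hlast] at hdet
    exact mul_right_cancel₀ hk.ne' (by rw [hdet, one_mul])
  have hpen : hjDenom b ℓ = r 1 := by
    have h : r 0 ∣ hjDenom b ℓ - r 1 := by
      refine hcop.dvd_of_dvd_mul_left ?_
      obtain ⟨m, hm⟩ := Int.modEq_iff_dvd.mp (Int.natCast_modEq_iff.mpr hsq)
      obtain ⟨q, hq⟩ := hdiv.1
      refine ⟨q + m, ?_⟩
      rw [hrl] at hq
      push_cast at hm
      rw [← hr0, ← hr1] at hm
      linear_combination hq + hm
    have hs := hmono ℓ le_rfl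
    have h1 := hdesc 1 le_rfl hℓ
    have h2 := hpos 1 le_rfl hℓ
    rw [Nat.sub_self] at h1
    have := Int.eq_zero_of_abs_lt_dvd h (by rw [abs_lt]; constructor <;> omega)
    omega
  intro i hi hil
  refine hj_expansion_unique (c := fun i => b (ℓ + 1 - i))
    (t := fun i => hjDenom b (ℓ + 1 - i)) hrec ?_
    (fun i hi hil => ⟨hnonneg i hi hil, hlt i hi hil⟩) ?_ hlast.symm hpen.symm hi hil
  · intro j hj hjl
    have h := hjDenom_succ b (i := ℓ + 1 - j) (by omega)
    have e1 : ℓ + 1 - j - 1 = ℓ + 1 - (j + 1) := by omega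
    have e2 : ℓ + 1 - j + 1 = ℓ + 1 - (j - 1) := by omega
    rw [e1, e2] at h
    linear_combination h
  · intro j hj hjl
    have h := hmono (ℓ + 1 - (j + 1)) (by omega)
    rwa [show ℓ + 1 - (j + 1) + 1 = ℓ + 1 - j by omega] at h
end

section
/- Let n ≥ 1 and let a be an integer with 0 < a < 2n and a² ≡ 1 (mod 2n). If the Hirzebruch–Jung continued fraction expansion 2n/a = [b₁, …, b_ℓ] has an even number ℓ of entries, then gcd(a+1, 2n) divides n (equivalently, the group BD_{2n}(a) contains a quasireflection). -/
/-- The continuants `K(b₁, …, b_{i-1})` attached to a Hirzebruch–Jung expansion. -/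
def hjContinuant (b : ℕ → ℤ) : ℕ → ℤ
  | 0 => 0
  | 1 => 1
  | i + 2 => b (i + 1) * hjContinuant b (i + 1) - hjContinuant b i

theorem hjContinuant_lt_succ {b : ℕ → ℤ} {ℓ : ℕ} (hb : ∀ i, 1 ≤ i → i ≤ ℓ → 2 ≤ b i) :
    ∀ i ≤ ℓ, 0 ≤ hjContinuant b i ∧ hjContinuant b i < hjContinuant b (i + 1) := by
  intro i
  induction i with
  | zero => simp [hjContinuant]
  | succ i ih =>
    intro hi
    obtain ⟨h0, h1⟩ := ih (by omega)
    have h2 := hb (i + 1) (by omega) hi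
    refine ⟨by omega, ?_⟩
    rw [hjContinuant]
    nlinarith

theorem hj_wronskian {b r : ℕ → ℤ} {ℓ : ℕ}
    (hrec : ∀ i, 1 ≤ i → i ≤ ℓ → r (i + 1) = b i * r i - r (i - 1)) :
    ∀ i ≤ ℓ, r i * hjContinuant b (i + 1) - r (i + 1) * hjContinuant b i = r 0 := by
  intro i
  induction i with
  | zero => simp [hjContinuant]
  | succ i ih =>
    intro hi
    have h := ih (by omega)
    have h2 := hrec (i + 1) (by omega) hi
    rw [Nat.add_sub_cancel] at h2
    rw [hjContinuant, h2]
    linear_combination h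

theorem hj_dvd_mul_continuant_sub {b r : ℕ → ℤ} {ℓ : ℕ}
    (hrec : ∀ i, 1 ≤ i → i ≤ ℓ → r (i + 1) = b i * r i - r (i - 1)) :
    ∀ i ≤ ℓ, r 0 ∣ r 1 * hjContinuant b i - r i ∧
      r 0 ∣ r 1 * hjContinuant b (i + 1) - r (i + 1) := by
  intro i
  induction i with
  | zero => simp [hjContinuant]
  | succ i ih =>
    intro hi
    obtain ⟨h0, h1⟩ := ih (by omega)
    have h2 := hrec (i + 1) (by omega) hi
    rw [Nat.add_sub_cancel] at h2
    refine ⟨h1, ?_⟩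
    rw [hjContinuant, h2]
    exact (dvd_sub (h1.mul_left (b (i + 1))) h0).trans (dvd_of_eq (by ring))

theorem Int.eq_of_dvd_sub_of_lt {m x y : ℤ} (h : m ∣ x - y) (hx : 0 ≤ x) (hx' : x < m)
    (hy : 0 ≤ y) (hy' : y < m) : x = y := by
  have := Int.eq_zero_of_abs_lt_dvd h (abs_lt.2 ⟨by omega, by omega⟩)
  omega

/-- A Hirzebruch–Jung remainder sequence is determined by its first two terms. -/
theorem hj_remainder_unique {b c r t : ℕ → ℤ} {ℓ : ℕ} (h0 : r 0 = t 0) (h1 : r 1 = t 1)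
    (hr : ∀ i, 1 ≤ i → i ≤ ℓ → r (i + 1) = b i * r i - r (i - 1))
    (ht : ∀ i, 1 ≤ i → i ≤ ℓ → t (i + 1) = c i * t i - t (i - 1))
    (hr0 : ∀ i, 1 ≤ i → i ≤ ℓ → 0 ≤ r (i + 1) ∧ r (i + 1) < r i)
    (ht0 : ∀ i, 1 ≤ i → i ≤ ℓ → 0 ≤ t (i + 1) ∧ t (i + 1) < t i) :
    ∀ i ≤ ℓ, r i = t i ∧ r (i + 1) = t (i + 1) := by
  intro i
  induction i with
  | zero => exact fun _ => ⟨h0, h1⟩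
  | succ i ih =>
    intro hi
    obtain ⟨e0, e1⟩ := ih (by omega)
    have hr2 := hr (i + 1) (by omega) hi
    have ht2 := ht (i + 1) (by omega) hi
    have hr3 := hr0 (i + 1) (by omega) hi
    have ht3 := ht0 (i + 1) (by omega) hi
    rw [Nat.add_sub_cancel] at hr2 ht2
    refine ⟨e1, Int.eq_of_dvd_sub_of_lt (m := r (i + 1)) ?_ hr3.1 hr3.2 ht3.1 (e1 ▸ ht3.2)⟩
    refine ⟨b (i + 1) - c (i + 1), ?_⟩
    rw [hr2, ht2, ← e0, ← e1]
    ring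

/-- If `r₁² ≡ 1 (mod r₀)`, then the Hirzebruch–Jung remainders are the continuants in reverse
order. -/
theorem hj_remainder_eq_continuant {b r : ℕ → ℤ} {ℓ : ℕ} (hℓ : 1 ≤ ℓ)
    (h1 : 0 < r 1) (h10 : r 1 < r 0) (hsq : r 0 ∣ r 1 ^ 2 - 1)
    (hrec : ∀ i, 1 ≤ i → i ≤ ℓ → r (i + 1) = b i * r i - r (i - 1))
    (hpos : ∀ i, 1 ≤ i → i ≤ ℓ → 0 < r i)
    (hnonneg : ∀ i, 1 ≤ i → i ≤ ℓ → 0 ≤ r (i + 1))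
    (hlt : ∀ i, 1 ≤ i → i ≤ ℓ → r (i + 1) < r i)
    (hend : r (ℓ + 1) = 0) :
    ∀ i ≤ ℓ, r i = hjContinuant b (ℓ + 1 - i) := by
  have hb : ∀ i, 1 ≤ i → i ≤ ℓ → 2 ≤ b i := by
    intro i hi hi'
    have e := hrec i hi hi'
    have p := hpos i hi hi'
    have q := hnonneg i hi hi'
    have l : r i < r (i - 1) := by
      rcases Nat.lt_or_ge 1 i with h | h
      · simpa [Nat.sub_add_cancel hi] using hlt (i - 1) (by omega) (by omega)
      · obtain rfl : i = 1 := by omega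
        exact h10
    by_contra! h
    nlinarith
  have hs := hjContinuant_lt_succ hb
  have hw := hj_wronskian hrec ℓ le_rfl
  obtain ⟨d0, d1⟩ := hj_dvd_mul_continuant_sub hrec ℓ le_rfl
  rw [hend, zero_mul, sub_zero] at hw
  rw [hend, sub_zero] at d1
  have hsl := hs ℓ le_rfl
  have dk : r 0 ∣ hjContinuant b (ℓ + 1) := by
    exact (dvd_sub (d1.mul_left (r 1)) (hsq.mul_right (hjContinuant b (ℓ + 1)))).trans
      (dvd_of_eq (by ring))
  have ek : hjContinuant b (ℓ + 1) = r 0 :=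
    Int.dvd_antisymm (by omega) (by omega) ⟨r ℓ, by linarith⟩ dk
  have el : r ℓ = 1 := by
    rw [ek] at hw
    exact mul_right_cancel₀ (b := r 0) (by omega) (by linarith)
  have ea : r 1 = hjContinuant b ℓ := by
    refine Int.eq_of_dvd_sub_of_lt (m := r 0) ?_ h1.le h10 hsl.1 (ek ▸ hsl.2)
    rw [el] at d0
    exact (dvd_sub (hsq.mul_right (hjContinuant b ℓ)) (d0.mul_left (r 1))).trans
      (dvd_of_eq (by ring))
  intro i hi
  refine (hj_remainder_unique (c := fun i => b (ℓ + 1 - i))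
    (t := fun i => hjContinuant b (ℓ + 1 - i)) ek.symm ea hrec ?_
    (fun i hi hi' => ⟨hnonneg i hi hi', hlt i hi hi'⟩) ?_ i hi).1
  · intro i hi hi'
    obtain ⟨j, rfl⟩ := Nat.exists_eq_add_of_le hi'
    have e1 : i + j + 1 - (i + 1) = j := by omega
    have e2 : i + j + 1 - i = j + 1 := by omega
    have e3 : i + j + 1 - (i - 1) = j + 2 := by omega
    simp only [e1, e2, e3, hjContinuant]
    ring
  · intro i hi hi'
    have e : ℓ + 1 - i = (ℓ + 1 - (i + 1)) + 1 := by omega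
    have := hs (ℓ + 1 - (i + 1)) (by omega)
    rwa [← e] at this


/-- If `a² ≡ 1 (mod 2n)` and the Hirzebruch–Jung continued fraction expansion
`2n/a = [b₁, …, b_ℓ]` has an even number `ℓ` of entries, then `gcd(a+1, 2n) ∣ n`
(equivalently, `BD_{2n}(a)` contains a quasireflection). The expansion is encoded by
the remainder sequence `r` as in the HJ recursion. -/
theorem stmt_5 (n : ℕ) (hn : 1 ≤ n) (a : ℕ) (ha0 : 0 < a) (ha : a < 2 * n)
    (hsq : a ^ 2 ≡ 1 [MOD 2 * n])
    (ℓ : ℕ) (hℓ : 1 ≤ ℓ) (b : ℕ → ℤ) (r : ℕ → ℤ)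
    (hr0 : r 0 = 2 * n) (hr1 : r 1 = a)
    (hrec : ∀ i, 1 ≤ i → i ≤ ℓ → r (i + 1) = b i * r i - r (i - 1))
    (hpos : ∀ i, 1 ≤ i → i ≤ ℓ → 0 < r i)
    (hnonneg : ∀ i, 1 ≤ i → i ≤ ℓ → 0 ≤ r (i + 1))
    (hlt : ∀ i, 1 ≤ i → i ≤ ℓ → r (i + 1) < r i)
    (hend : r (ℓ + 1) = 0)
    (heven : Even ℓ) :
    Nat.gcd (a + 1) (2 * n) ∣ n := by
  have hsq' : r 0 ∣ r 1 ^ 2 - 1 := by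
    rw [hr0, hr1]
    have := Nat.modEq_iff_dvd.1 hsq.symm
    push_cast at this
    exact this
  have hrefl := hj_remainder_eq_continuant hℓ (by omega) (by omega) hsq' hrec hpos hnonneg hlt hend
  obtain ⟨m, rfl⟩ := heven
  have hp := hrefl m (by omega)
  have hq := hrefl (m + 1) (by omega)
  rw [show m + m + 1 - m = m + 1 by omega] at hp
  rw [show m + m + 1 - (m + 1) = m by omega] at hq
  have hw := hj_wronskian hrec m (by omega)
  obtain ⟨⟨u, hu⟩, -⟩ := hj_dvd_mul_continuant_sub hrec m (by omega)
  rw [← hp, ← hq, hr0] at hw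
  rw [← hq, hr0, hr1] at hu
  have hg : ((Nat.gcd (a + 1) (2 * n) : ℕ) : ℤ) ∣ r m + r (m + 1) := by
    have g1 : ((Nat.gcd (a + 1) (2 * n) : ℕ) : ℤ) ∣ (a : ℤ) + 1 := by
      exact_mod_cast Nat.gcd_dvd_left (a + 1) (2 * n)
    have g2 : ((Nat.gcd (a + 1) (2 * n) : ℕ) : ℤ) ∣ 2 * n := by
      exact_mod_cast Nat.gcd_dvd_right (a + 1) (2 * n)
    exact (dvd_sub (g1.mul_right (r (m + 1))) (g2.mul_right u)).trans
      (dvd_of_eq (by linear_combination hu))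
  have hev : Even (r m - r (m + 1)) := by
    have h : Even ((r m - r (m + 1)) * (r m + r (m + 1))) :=
      even_iff_two_dvd.2 ⟨n, by linear_combination hw⟩
    rcases Int.even_mul.1 h with h | h
    · exact h
    · exact Int.even_sub.2 (Int.even_add.1 h)
  obtain ⟨v, hv⟩ := hev
  have hn' : (n : ℤ) = (r m + r (m + 1)) * v := by
    refine mul_left_cancel₀ (two_ne_zero (α := ℤ)) ?_
    linear_combination -hw + (r m + r (m + 1)) * hv
  exact Int.natCast_dvd_natCast.1 (hn' ▸ hg.mul_right v)
end

section
/- Let n ≥ 1 and let a be an integer with 0 < a < 2n, a² ≡ 1 (mod 2n), and suppose gcd(a+1, 2n) does not divide n. Set q = 2n / gcd(a−1, 2n). Then q divides n and the quotient m = n/q is odd. -/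
/-- If `a² ≡ 1 (mod 2n)` and `gcd(a+1, 2n) ∤ n`, then `q = 2n / gcd(a−1, 2n)`
divides `n` and `m = n/q` is odd. -/
theorem stmt_7 (n : ℕ) (hn : 1 ≤ n) (a : ℕ) (ha0 : 0 < a) (ha : a < 2 * n)
    (hsq : a ^ 2 ≡ 1 [MOD 2 * n])
    (hsmall : ¬ (Nat.gcd (a + 1) (2 * n) ∣ n))
    (q : ℕ) (hq : q = 2 * n / Nat.gcd (a - 1) (2 * n)) :
    q ∣ n ∧ Odd (n / q) := by
  have hd : Nat.gcd (a - 1) (2 * n) ∣ 2 * n := Nat.gcd_dvd_right _ _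
  have hda : Nat.gcd (a - 1) (2 * n) ∣ a - 1 := Nat.gcd_dvd_left _ _
  have hodd : Odd a := by
    have h2 : a ^ 2 ≡ 1 [MOD 2] := hsq.of_mul_right n
    exact (Nat.odd_pow_iff two_ne_zero).mp (Nat.odd_iff.mpr h2)
  obtain ⟨c, hc⟩ : 2 ∣ Nat.gcd (a - 1) (2 * n) :=
    Nat.dvd_gcd (by grind) (Dvd.intro n rfl)
  have hcodd : Odd c := by
    by_contra heven
    rw [Nat.not_odd_iff_even] at heven
    obtain ⟨b, rfl⟩ := heven
    have h4 : 4 ∣ Nat.gcd (a - 1) (2 * n) := ⟨b, by omega⟩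
    have h4a : 4 ∣ a - 1 := h4.trans hda
    have h4n : 4 ∣ 2 * n := h4.trans hd
    obtain ⟨m, rfl⟩ : 2 ∣ n := by omega
    obtain ⟨f, hf⟩ : 2 ∣ a + 1 := by omega
    have hfodd : Nat.Coprime f 2 := by
      rw [Nat.coprime_two_right]
      exact Nat.odd_iff.mpr (by omega)
    apply hsmall
    rw [hf, Nat.gcd_mul_left, Nat.Coprime.gcd_mul_left_cancel_right m hfodd.symm]
    exact mul_dvd_mul_left 2 (Nat.gcd_dvd_right f m)
  have hqn : n = c * q := by
    have h := Nat.mul_div_cancel' hd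
    rw [← hq, hc] at h
    linarith
  have hqpos : 0 < q := Nat.pos_of_ne_zero (by rintro rfl; omega)
  refine ⟨⟨c, by rw [hqn, mul_comm]⟩, ?_⟩
  rwa [hqn, Nat.mul_div_cancel c hqpos]
end

section
/- Let n ≥ 1 and let a be an integer with 0 < a < 2n, gcd(a,2n) = 1 and a² ≡ 1 (mod 2n). Let ε ∈ ℂ be a primitive 2n-th root of unity, α = [[ε,0],[0,ε^a]], β = [[0,1],[-1,0]] ∈ GL(2,ℂ), and let G be the subgroup of GL(2,ℂ) generated by α and β. Then the commutator subgroup of G equals the cyclic subgroup generated by α^{a−1}, and this subgroup has order 2n / gcd(a−1, 2n). -/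
open Matrix

open scoped commutatorElement in
/-- If the generators `s` normalize `N` and their commutators lie in `N`, then the commutator
subgroup of `closure s` is contained in `N`. -/
theorem Subgroup.commutator_closure_self_le {G : Type*} [Group G] {s : Set G} {N : Subgroup G}
    (hs : ∀ g ∈ s, ∀ x, x ∈ N ↔ g * x * g⁻¹ ∈ N) (hcomm : ∀ g ∈ s, ∀ h ∈ s, ⁅g, h⁆ ∈ N) :
    ⁅Subgroup.closure s, Subgroup.closure s⁆ ≤ N := by
  have hnorm : ∀ g ∈ Subgroup.closure s, ∀ x, x ∈ N ↔ g * x * g⁻¹ ∈ N := by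
    intro g hg
    induction hg using Subgroup.closure_induction with
    | mem g hg => exact hs g hg
    | one => simp
    | mul g h _ _ ihg ihh =>
      intro x
      rw [ihh, ihg]
      simp [mul_assoc]
    | inv g _ ih =>
      intro x
      rw [ih (g⁻¹ * x * g⁻¹⁻¹)]
      simp [mul_assoc]
  have hright : ∀ g : G, (∀ h ∈ s, ⁅g, h⁆ ∈ N) → ∀ h ∈ Subgroup.closure s, ⁅g, h⁆ ∈ N := by
    intro g hg h hh
    induction hh using Subgroup.closure_induction with
    | mem h hh => exact hg h hh
    | one => simp
    | mul h k hh _ ihh ihk =>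
      rw [commutatorElement_mul_right_eq_mul_conj, mul_assoc, mul_assoc, ← mul_assoc h]
      exact N.mul_mem ihh ((hnorm h hh _).1 ihk)
    | inv h hh ih =>
      rw [hnorm h hh]
      have key : h * ⁅g, h⁻¹⁆ * h⁻¹ = ⁅g, h⁆⁻¹ := by
        simp only [commutatorElement_def]; group
      rw [key]
      exact N.inv_mem ih
  have hsymm : ∀ {g h : G}, ⁅g, h⁆ ∈ N → ⁅h, g⁆ ∈ N := fun {g h} hgh => by
    rw [← commutatorElement_inv]
    exact N.inv_mem hgh
  rw [Subgroup.commutator_le]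
  intro g hg h hh
  exact hright g (fun k hk => hsymm (hright k (hcomm k hk) g hg)) h hh

open scoped commutatorElement in
/-- If `B` conjugates `A` to `A ^ a` and `A ^ a` to `A`, the commutator subgroup of `⟨A, B⟩` is
generated by `A ^ (a - 1)`. -/
theorem Subgroup.commutator_closure_pair_eq_zpowers {G : Type*} [Group G] {A B : G} {a : ℕ}
    (ha : 0 < a) (hconj : B * A * B⁻¹ = A ^ a) (hconj' : B * A ^ a * B⁻¹ = A) :
    ⁅Subgroup.closure ({A, B} : Set G), Subgroup.closure ({A, B} : Set G)⁆ =
      Subgroup.zpowers (A ^ (a - 1)) := by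
  have hcomm : ⁅B, A⁆ = A ^ (a - 1) := by
    rw [commutatorElement_def, hconj, mul_inv_eq_iff_eq_mul, ← pow_succ, Nat.sub_add_cancel ha]
  apply le_antisymm
  · apply Subgroup.commutator_closure_self_le
    · rintro g (rfl | rfl) x
      · constructor
        · rintro ⟨k, rfl⟩
          refine ⟨k, ?_⟩
          exact eq_mul_inv_of_mul_eq (((Commute.refl g).pow_left _).zpow_left k).eq
        · rintro ⟨k, hk⟩
          refine ⟨k, ?_⟩
          have h := (((Commute.refl g).pow_left (a - 1)).zpow_left k).eq
          dsimp only at hk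
          rw [hk] at h
          dsimp only
          rw [hk]
          simpa using h.symm
      · have hinv : g⁻¹ * A * g = A ^ a := by
          nth_rw 1 [← hconj']
          group
        constructor
        · rintro ⟨k, rfl⟩
          refine ⟨a * k, ?_⟩
          dsimp only
          rw [← conj_zpow, ← conj_pow, hconj, _root_.zpow_mul, zpow_natCast, ← pow_mul, ← pow_mul,
            mul_comm]
        · rintro ⟨k, hk⟩
          refine ⟨a * k, ?_⟩
          have hx : x = g⁻¹ * (A ^ (a - 1)) ^ k * g⁻¹⁻¹ := by
            dsimp only at hk
            rw [hk]; group
          dsimp only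
          rw [hx, ← conj_zpow, ← conj_pow, inv_inv, hinv, _root_.zpow_mul, zpow_natCast, ← pow_mul,
            ← pow_mul, mul_comm]
    · rintro g (rfl | rfl) h (rfl | rfl)
      · simp
      · rw [← commutatorElement_inv, hcomm]
        exact Subgroup.inv_mem _ (Subgroup.mem_zpowers _)
      · rw [hcomm]
        exact Subgroup.mem_zpowers _
      · simp
  · rw [Subgroup.zpowers_le, ← hcomm]
    exact Subgroup.commutator_mem_commutator (Subgroup.subset_closure (by simp))
      (Subgroup.subset_closure (by simp))

/-- The commutator subgroup of `G = BD_{2n}(a)` equals the cyclic subgroup generated by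
`α^{a−1}`, and this subgroup has order `2n / gcd(a−1, 2n)`. -/
theorem stmt_8 (n a : ℕ) (hn : 1 ≤ n) (ha0 : 0 < a) (ha : a < 2 * n)
    (hgcd : Nat.gcd a (2 * n) = 1) (hsq : a ^ 2 ≡ 1 [MOD 2 * n])
    (ε : ℂ) (hε : IsPrimitiveRoot ε (2 * n))
    (A B : GL (Fin 2) ℂ)
    (hA : (A : Matrix (Fin 2) (Fin 2) ℂ) = !![ε, 0; 0, ε ^ a])
    (hB : (B : Matrix (Fin 2) (Fin 2) ℂ) = !![0, 1; -1, 0]) :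
    ⁅Subgroup.closure ({A, B} : Set (GL (Fin 2) ℂ)),
        Subgroup.closure ({A, B} : Set (GL (Fin 2) ℂ))⁆ =
      Subgroup.zpowers (A ^ (a - 1)) ∧
    Nat.card (Subgroup.zpowers (A ^ (a - 1))) = 2 * n / Nat.gcd (a - 1) (2 * n) := by
  have hεa : (ε ^ a) ^ a = ε := by
    rw [hε.eq_orderOf, Nat.ModEq] at hsq
    rw [← pow_mul, ← sq, ← pow_mod_orderOf, hsq, pow_mod_orderOf, pow_one]
  have hApow : ∀ k : ℕ, ((A ^ k : GL (Fin 2) ℂ) : Matrix (Fin 2) (Fin 2) ℂ) =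
      !![ε ^ k, 0; 0, (ε ^ a) ^ k] := by
    intro k
    induction k with
    | zero => simp [Matrix.one_fin_two]
    | succ k ih =>
      rw [pow_succ, Units.val_mul, ih, hA]
      simp [pow_succ]
  have hconj : B * A * B⁻¹ = A ^ a := by
    rw [mul_inv_eq_iff_eq_mul]
    ext1
    rw [Units.val_mul, Units.val_mul, hApow, hA, hB, hεa]
    simp
  have hconj' : B * A ^ a * B⁻¹ = A := by
    rw [mul_inv_eq_iff_eq_mul]
    ext1
    rw [Units.val_mul, Units.val_mul, hApow, hA, hB, hεa]
    simp
  have horder : orderOf A = 2 * n := by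
    rw [hε.eq_orderOf]
    refine orderOf_eq_orderOf_iff.2 fun k => ⟨fun h => ?_, fun h => ?_⟩
    · have h' := hApow k
      rw [h] at h'
      simpa using (congrFun (congrFun h' 0) 0).symm
    · ext1
      rw [hApow, ← pow_mul, mul_comm, pow_mul, h]
      simp [Matrix.one_fin_two]
  refine ⟨Subgroup.commutator_closure_pair_eq_zpowers ha0 hconj hconj', ?_⟩
  have hfin : IsOfFinOrder A := orderOf_pos_iff.1 (by omega)
  rw [Nat.card_zpowers, hfin.orderOf_pow, horder, Nat.gcd_comm]
end

section
/- Let n ≥ 1 and let a be an integer with gcd(a,2n) = 1 and a² ≡ 1 (mod 2n), and let ε ∈ ℂ be a primitive 2n-th root of unity. Let r, s, u, v be nonnegative integers with r ≤ u, v ≤ s, a·r ≡ s (mod 2n) and a·u ≡ v (mod 2n). Then the polynomial f(x,y) = x^{s−v}·y^{u−r} + (−1)^{u−r}·x^{u−r}·y^{s−v} is invariant under the action of BD_{2n}(a): for all x, y ∈ ℂ, f(ε·x, ε^a·y) = f(x,y) and f(y, −x) = f(x,y). -/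
/-- If `a·r ≡ s` and `a·u ≡ v (mod 2n)` with `r ≤ u`, `v ≤ s`, then the polynomial
`f(x,y) = x^{s−v}·y^{u−r} + (−1)^{u−r}·x^{u−r}·y^{s−v}` is invariant under the
`BD_{2n}(a)`-action: `f(ε·x, ε^a·y) = f(x,y)` and `f(y, −x) = f(x,y)`. -/
theorem stmt_9 (n a : ℕ) (hn : 1 ≤ n)
    (hgcd : Nat.gcd a (2 * n) = 1) (hsq : a ^ 2 ≡ 1 [MOD 2 * n])
    (ε : ℂ) (hε : IsPrimitiveRoot ε (2 * n))
    (r s u v : ℕ) (hru : r ≤ u) (hvs : v ≤ s)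
    (hrs : a * r ≡ s [MOD 2 * n]) (huv : a * u ≡ v [MOD 2 * n]) :
    ∀ x y : ℂ,
      ((ε * x) ^ (s - v) * (ε ^ a * y) ^ (u - r) +
          (-1 : ℂ) ^ (u - r) * (ε * x) ^ (u - r) * (ε ^ a * y) ^ (s - v) =
        x ^ (s - v) * y ^ (u - r) + (-1 : ℂ) ^ (u - r) * x ^ (u - r) * y ^ (s - v)) ∧
      (y ^ (s - v) * (-x) ^ (u - r) + (-1 : ℂ) ^ (u - r) * y ^ (u - r) * (-x) ^ (s - v) =
        x ^ (s - v) * y ^ (u - r) + (-1 : ℂ) ^ (u - r) * x ^ (u - r) * y ^ (s - v)) := by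
  obtain ⟨p, rfl⟩ := Nat.exists_eq_add_of_le hvs
  obtain ⟨q, rfl⟩ := Nat.exists_eq_add_of_le hru
  simp only [Nat.add_sub_cancel_left]
  have hpq : 2 * n ∣ p + a * q := by
    have h : a * r + (p + a * q) ≡ a * r + 0 [MOD 2 * n] := calc
      a * r + (p + a * q) = a * (r + q) + p := by ring
      _ ≡ v + p [MOD 2 * n] := huv.add_right p
      _ ≡ a * r + 0 [MOD 2 * n] := hrs.symm
    exact (Nat.modEq_zero_iff_dvd).1 (Nat.ModEq.add_left_cancel' _ h)
  have hqp : 2 * n ∣ q + a * p := by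
    refine (Nat.modEq_zero_iff_dvd).1 ?_
    calc
      q + a * p = 1 * q + a * p := by ring
      _ ≡ a ^ 2 * q + a * p [MOD 2 * n] := (hsq.symm.mul_right q).add_right _
      _ = a * (p + a * q) := by ring
      _ ≡ 0 [MOD 2 * n] := (Nat.modEq_zero_iff_dvd).2 (hpq.mul_left a)
  have hodd : Odd a :=
    Nat.coprime_two_right.1 (Nat.Coprime.coprime_mul_right_right hgcd)
  have heven : Even (p + q) := by
    have h : Even (p + a * q) := even_iff_two_dvd.2 ((dvd_mul_right 2 n).trans hpq)
    rw [Nat.even_add, Nat.even_mul] at h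
    rw [Nat.even_add]
    simpa [Nat.not_even_iff_odd.2 hodd] using h
  have hε₁ : ε ^ (p + a * q) = 1 := (hε.pow_eq_one_iff_dvd _).2 hpq
  have hε₂ : ε ^ (q + a * p) = 1 := (hε.pow_eq_one_iff_dvd _).2 hqp
  have hsign : (-1 : ℂ) ^ (p + q) = 1 := heven.neg_one_pow
  rw [pow_add, pow_mul] at hε₁ hε₂
  rw [pow_add] at hsign
  intro x y
  constructor
  · simp only [mul_pow]
    linear_combination x ^ p * y ^ q * hε₁ + (-1) ^ q * x ^ q * y ^ p * hε₂
  · rw [neg_pow x q, neg_pow x p]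
    linear_combination x ^ p * y ^ q * hsign
end

section
/- Let n ≥ 1 and let a be an integer with gcd(a,2n) = 1 and a² ≡ 1 (mod 2n); let ε ∈ ℂ be a primitive 2n-th root of unity and set q = 2n / gcd(a−1, 2n). Let r, s be nonnegative integers with r ≤ s, r ≡ s (mod 2), and a·r ≡ s (mod 2n). Then for every integer i ≥ 0 with i·q ≤ s−r, the polynomial f_i(x,y) = x^{s−r+iq}·y^{s−r−iq} + (−1)^{iq}·x^{s−r−iq}·y^{s−r+iq} is invariant under the action of BD_{2n}(a): for all x, y ∈ ℂ, f_i(ε·x, ε^a·y) = f_i(x,y) and f_i(y, −x) = f_i(x,y). In particular (i = 0) the monomial x^{s−r}·y^{s−r} is G-invariant. -/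
/-- A monomial `x ^ u * y ^ v` is invariant under `diag(ε, ε ^ a)` when `ε ^ (u + a * v) = 1`. -/
theorem mul_pow_mul_mul_pow_eq_of_pow_eq_one {R : Type*} [CommMonoid R] {ε : R} {a u v : ℕ}
    (h : ε ^ (u + a * v) = 1) (x y : R) :
    (ε * x) ^ u * (ε ^ a * y) ^ v = x ^ u * y ^ v := by
  rw [mul_pow, mul_pow, ← pow_mul, mul_mul_mul_comm, ← pow_add, h, one_mul]

/-- If `a ^ 2 ≡ 1` and `a * r ≡ s` modulo `N`, then `N` divides `(s - r) * (1 + a)`. -/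
theorem Int.dvd_sub_mul_one_add_of_modEq {N a r s : ℤ} (hsq : a ^ 2 ≡ 1 [ZMOD N])
    (hmod : a * r ≡ s [ZMOD N]) : N ∣ (s - r) * (1 + a) := by
  obtain ⟨k, hk⟩ := hsq.dvd
  obtain ⟨l, hl⟩ := hmod.dvd
  exact ⟨l * (1 + a) - r * k, by linear_combination (1 + a) * hl - r * hk⟩

theorem Nat.dvd_div_gcd_mul (N b : ℕ) : N ∣ N / Nat.gcd b N * b := by
  rw [Nat.div_mul_right_comm (Nat.gcd_dvd_right b N), Nat.mul_div_assoc _ (Nat.gcd_dvd_left b N)]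
  exact Dvd.intro _ rfl


/-- With `q = 2n / gcd(a−1, 2n)`, `r ≤ s`, `r ≡ s (mod 2)` and `a·r ≡ s (mod 2n)`:
for every `i ≥ 0` with `i·q ≤ s−r`, the polynomial
`f_i(x,y) = x^{s−r+iq}·y^{s−r−iq} + (−1)^{iq}·x^{s−r−iq}·y^{s−r+iq}` is invariant under
the `BD_{2n}(a)`-action; in particular (`i = 0`) the monomial `x^{s−r}·y^{s−r}` is
`G`-invariant. -/
theorem stmt_11 (n a : ℕ) (hn : 1 ≤ n)
    (hgcd : Nat.gcd a (2 * n) = 1) (hsq : a ^ 2 ≡ 1 [MOD 2 * n])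
    (ε : ℂ) (hε : IsPrimitiveRoot ε (2 * n))
    (q : ℕ) (hq : q = 2 * n / Nat.gcd (a - 1) (2 * n))
    (r s : ℕ) (hrs : r ≤ s) (hpar : r % 2 = s % 2) (hmod : a * r ≡ s [MOD 2 * n]) :
    (∀ i : ℕ, i * q ≤ s - r → ∀ x y : ℂ,
      ((ε * x) ^ (s - r + i * q) * (ε ^ a * y) ^ (s - r - i * q) +
          (-1 : ℂ) ^ (i * q) * (ε * x) ^ (s - r - i * q) * (ε ^ a * y) ^ (s - r + i * q) =
        x ^ (s - r + i * q) * y ^ (s - r - i * q) +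
          (-1 : ℂ) ^ (i * q) * x ^ (s - r - i * q) * y ^ (s - r + i * q)) ∧
      (y ^ (s - r + i * q) * (-x) ^ (s - r - i * q) +
          (-1 : ℂ) ^ (i * q) * y ^ (s - r - i * q) * (-x) ^ (s - r + i * q) =
        x ^ (s - r + i * q) * y ^ (s - r - i * q) +
          (-1 : ℂ) ^ (i * q) * x ^ (s - r - i * q) * y ^ (s - r + i * q))) ∧
    (∀ x y : ℂ,
      ((ε * x) ^ (s - r) * (ε ^ a * y) ^ (s - r) = x ^ (s - r) * y ^ (s - r)) ∧
      (y ^ (s - r) * (-x) ^ (s - r) = x ^ (s - r) * y ^ (s - r))) := by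
  have ha : 1 ≤ a := by
    rcases Nat.eq_zero_or_pos a with rfl | h
    · rw [Nat.gcd_zero_left] at hgcd
      omega
    · exact h
  have hd : ((2 * n : ℕ) : ℤ) ∣ ((s - r : ℕ) : ℤ) * (1 + a) := by
    rw [Nat.cast_sub hrs]
    refine Int.dvd_sub_mul_one_add_of_modEq ?_ ?_
    · exact_mod_cast Int.natCast_modEq_iff.2 hsq
    · exact_mod_cast Int.natCast_modEq_iff.2 hmod
  have hqa : ((2 * n : ℕ) : ℤ) ∣ (q : ℤ) * (a - 1) := by
    have h := Int.natCast_dvd_natCast.2 (Nat.dvd_div_gcd_mul (2 * n) (a - 1))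
    rwa [← hq, Nat.cast_mul q, Nat.cast_sub ha, Nat.cast_one] at h
  have heven : Even (s - r) := by
    rw [Nat.even_iff]
    omega
  generalize s - r = d at hd heven ⊢
  refine ⟨fun i hi x y => ?_, fun x y => ⟨?_, ?_⟩⟩
  · have hm := hqa.mul_left (i : ℤ)
    have h₁ : ε ^ (d + i * q + a * (d - i * q)) = 1 := by
      rw [hε.pow_eq_one_iff_dvd, ← Int.natCast_dvd_natCast]
      refine (dvd_sub hd hm).trans (dvd_of_eq ?_)
      push_cast [Nat.cast_sub hi]
      ring
    have h₂ : ε ^ (d - i * q + a * (d + i * q)) = 1 := by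
      rw [hε.pow_eq_one_iff_dvd, ← Int.natCast_dvd_natCast]
      refine (dvd_add hd hm).trans (dvd_of_eq ?_)
      push_cast [Nat.cast_sub hi]
      ring
    refine ⟨?_, ?_⟩
    · rw [mul_assoc ((-1 : ℂ) ^ (i * q)), mul_pow_mul_mul_pow_eq_of_pow_eq_one h₁,
        mul_pow_mul_mul_pow_eq_of_pow_eq_one h₂, mul_assoc ((-1 : ℂ) ^ (i * q))]
    · have hsub : (-1 : ℂ) ^ (d - i * q) = (-1) ^ (i * q) := by
        rw [neg_one_pow_eq_pow_mod_two, neg_one_pow_eq_pow_mod_two (n := i * q)]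
        congr 1
        rw [Nat.even_iff] at heven
        omega
      have hsign : (-1 : ℂ) ^ (i * q) * (-1) ^ (i * q) = 1 := by
        rw [← mul_pow]
        simp
      rw [neg_pow x, neg_pow x (d + i * q), hsub, pow_add (-1 : ℂ) d, heven.neg_one_pow]
      linear_combination y ^ (d - i * q) * x ^ (d + i * q) * hsign
  · refine mul_pow_mul_mul_pow_eq_of_pow_eq_one ?_ x y
    rw [hε.pow_eq_one_iff_dvd, ← Int.natCast_dvd_natCast]
    convert hd using 1
    push_cast
    ring
  · rw [heven.neg_pow, mul_comm]
end

section
/- Let r, s, u, v be integers with 0 ≤ r < u ≤ v < s, u < s−v, and u−r ≡ s−v (mod 2). Let I be the ideal of ℂ[x,y] generated by x^u·y^u, x^{s−v}·y^{u−r} + (−1)^{u−r}·x^{u−r}·y^{s−v}, and x^{r+s} + (−1)^r·y^{r+s}. Then the quotient ℂ[x,y]/I is a finite-dimensional ℂ-vector space of dimension 2·(s·u − r·v). -/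
open MvPolynomial

/-- If `f` and `h` have no common factor, multiplication by `f` gives a short exact sequence
`0 → R ⧸ (K + (h)) → R ⧸ (f K + (h)) → R ⧸ (f, h) → 0`. -/
theorem rank_quotient_mul_sup {k R : Type*} [Field k] [CommRing R] [IsDomain R] [Algebra k R]
    {f h : R} (hf : f ≠ 0) (hfh : ∀ a, f ∣ h * a → f ∣ a) (K : Ideal R) :
    Module.rank k (R ⧸ (Ideal.span {f} * K ⊔ Ideal.span {h})) =
      Module.rank k (R ⧸ (K ⊔ Ideal.span {h})) +
        Module.rank k (R ⧸ (Ideal.span {f} ⊔ Ideal.span {h})) := by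
  set A := Ideal.span {f} * K ⊔ Ideal.span {h}
  set B := K ⊔ Ideal.span {h}
  set C := Ideal.span {f} ⊔ Ideal.span {h}
  have mem_A {a : R} : f * a ∈ A ↔ a ∈ B := by
    simp only [A, B, Submodule.mem_sup, Ideal.mem_span_singleton_mul, Ideal.mem_span_singleton']
    constructor
    · rintro ⟨_, ⟨z, hz, rfl⟩, _, ⟨w, rfl⟩, e⟩
      obtain ⟨t, rfl⟩ := hfh w ⟨a - z, by linear_combination e⟩
      exact ⟨z, hz, t * h, ⟨t, rfl⟩, mul_left_cancel₀ hf (by linear_combination e)⟩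
    · rintro ⟨z, hz, _, ⟨w, rfl⟩, rfl⟩
      exact ⟨_, ⟨z, hz, rfl⟩, f * w * h, ⟨f * w, rfl⟩, by ring⟩
  have hAC : A ≤ C := sup_le_sup_right Ideal.mul_le_left _
  let ψ : (R ⧸ B) →ₗ[R] (R ⧸ A) :=
    Submodule.mapQ B A (LinearMap.mulLeft R f) fun _ ha ↦ mem_A.2 ha
  let π : (R ⧸ A) →ₗ[R] (R ⧸ C) := Submodule.mapQ A C LinearMap.id hAC
  have hψ : Function.Injective ψ := by
    rw [injective_iff_map_eq_zero]
    rintro ⟨x⟩ hx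
    exact (Submodule.Quotient.mk_eq_zero B).2 (mem_A.1 ((Submodule.Quotient.mk_eq_zero A).1 hx))
  have hπ : Function.Surjective π := by
    rintro ⟨x⟩
    exact ⟨Submodule.Quotient.mk x, rfl⟩
  have hker : LinearMap.ker π = LinearMap.range ψ := by
    ext x
    obtain ⟨x, rfl⟩ := Submodule.Quotient.mk_surjective _ x
    have hx : Submodule.Quotient.mk x ∈ LinearMap.ker π ↔ x ∈ C :=
      Submodule.Quotient.mk_eq_zero C
    rw [hx]
    constructor
    · simp only [C, Submodule.mem_sup, Ideal.mem_span_singleton']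
      rintro ⟨_, ⟨a, rfl⟩, _, ⟨b, rfl⟩, rfl⟩
      refine ⟨Submodule.Quotient.mk a, (Submodule.Quotient.eq A).2 ?_⟩
      refine Submodule.mem_sup_right (Ideal.mem_span_singleton'.2 ⟨-b, ?_⟩)
      simp
      ring
    · rintro ⟨y, hy⟩
      obtain ⟨y, rfl⟩ := Submodule.Quotient.mk_surjective _ y
      have := hAC ((Submodule.Quotient.eq A).1 hy)
      have h2 : f * y ∈ C := Ideal.mul_mem_right _ _ (Submodule.mem_sup_left
        (Ideal.mem_span_singleton_self f))
      simpa using C.sub_mem h2 this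
  have hker' : LinearMap.ker (π.restrictScalars k) = LinearMap.range (ψ.restrictScalars k) := by
    ext x
    exact SetLike.ext_iff.1 hker x
  rw [← LinearMap.rank_range_add_rank_ker (π.restrictScalars k), hker',
    rank_range_of_injective (ψ.restrictScalars k) hψ,
    rank_range_of_surjective (π.restrictScalars k) hπ, add_comm]

theorem rank_quotient_pair_mul {k R : Type*} [Field k] [CommRing R] [IsDomain R]
    [UniqueFactorizationMonoid R] [Algebra k R] {f h : R} (hf : f ≠ 0) (hfh : IsRelPrime f h)
    (g : R) :
    Module.rank k (R ⧸ Ideal.span {f * g, h}) =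
      Module.rank k (R ⧸ Ideal.span {g, h}) + Module.rank k (R ⧸ Ideal.span {f, h}) := by
  have key := rank_quotient_mul_sup (k := k) hf (fun _ ↦ hfh.dvd_of_dvd_mul_left) (Ideal.span {g})
  rw [Ideal.span_singleton_mul_span_singleton] at key
  rw [Ideal.span_insert, Ideal.span_insert, Ideal.span_insert, key]

theorem rank_quotient_pair_pow {k R : Type*} [Field k] [CommRing R] [IsDomain R]
    [UniqueFactorizationMonoid R] [Algebra k R] {f h : R} (hf : f ≠ 0) (hfh : IsRelPrime f h)
    (n : ℕ) :
    Module.rank k (R ⧸ Ideal.span {f ^ n, h}) = n * Module.rank k (R ⧸ Ideal.span {f, h}) := by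
  induction n with
  | zero =>
    have : Ideal.span {1, h} = ⊤ := (Ideal.eq_top_iff_one _).2 (Ideal.subset_span (by simp))
    have : Subsingleton (R ⧸ Ideal.span {1, h}) := Ideal.Quotient.subsingleton_iff.2 this
    rw [pow_zero, rank_subsingleton', Nat.cast_zero, zero_mul]
  | succ n ih => rw [pow_succ', rank_quotient_pair_mul hf hfh, ih]; push_cast; ring

theorem rank_quotient_X_X (k : Type*) [Field k] :
    Module.rank k (MvPolynomial (Fin 2) k ⧸ Ideal.span {(X 0 : MvPolynomial (Fin 2) k), X 1}) =
      1 := by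
  let φ : MvPolynomial (Fin 2) k →ₐ[k] k := aeval 0
  have hs : Function.Surjective φ := fun c ↦ ⟨C c, by simp [φ]⟩
  have hker : Ideal.span {X 0, X 1} = RingHom.ker φ := by
    have himage : ({X 0, X 1} : Set (MvPolynomial (Fin 2) k)) = X '' Set.univ := by
      ext; simp [eq_comm]
    ext p
    rw [himage, mem_ideal_span_X_image, RingHom.mem_ker,
      show φ p = constantCoeff p from aeval_zero p, constantCoeff_eq, ← notMem_support_iff]
    refine ⟨fun h h0 ↦ by simpa using h 0 h0, fun h0 m hm ↦ ?_⟩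
    by_contra! hm0
    exact h0 ((show m = 0 from Finsupp.ext fun i ↦ hm0 i trivial) ▸ hm)
  rw [hker, (Ideal.quotientKerAlgEquivOfSurjective hs).toLinearEquiv.rank_eq, Module.rank_self]

theorem isRelPrime_X {k : Type*} [Field k] {i j : Fin 2} (hij : i ≠ j) :
    IsRelPrime (X i : MvPolynomial (Fin 2) k) (X j) := by
  rw [X_prime.irreducible.isRelPrime_iff_not_dvd, X_dvd_X]
  exact hij

theorem isRelPrime_X_pow_add {k : Type*} [Field k] {i j : Fin 2} (hij : i ≠ j)
    {c : MvPolynomial (Fin 2) k} (hc : IsUnit c) {m : ℕ} (hm : m ≠ 0) :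
    IsRelPrime (X i) (X i ^ m + c * X j ^ m) := by
  rw [X_prime.irreducible.isRelPrime_iff_not_dvd, dvd_add_right (dvd_pow_self _ hm), hc.dvd_mul_left]
  exact fun h ↦ hij (X_dvd_X.1 (X_prime.dvd_of_dvd_pow h))

theorem isRelPrime_X_pow_add_mul_self_pow {k : Type*} [Field k] {i j : Fin 2} (hij : i ≠ j)
    (c : MvPolynomial (Fin 2) k) {m : ℕ} (hm : m ≠ 0) :
    IsRelPrime (X i) (X j ^ m + c * X i ^ m) := by
  rw [X_prime.irreducible.isRelPrime_iff_not_dvd, dvd_add_left ((dvd_pow_self _ hm).mul_left _)]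
  exact fun h ↦ hij (X_dvd_X.1 (X_prime.dvd_of_dvd_pow h))

theorem rank_quotient_X_pow_add {k : Type*} [Field k] {i j : Fin 2} (hij : i ≠ j)
    {c : MvPolynomial (Fin 2) k} (hc : IsUnit c) {m : ℕ} (hm : m ≠ 0) :
    Module.rank k (MvPolynomial (Fin 2) k ⧸
      Ideal.span {X i, (X i ^ m + c * X j ^ m : MvPolynomial (Fin 2) k)}) = m := by
  obtain ⟨c', hc'⟩ := hc.exists_left_inv
  have hspan : Ideal.span {X i, X i ^ m + c * X j ^ m} = Ideal.span {X j ^ m, X i} := by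
    obtain ⟨n, rfl⟩ := Nat.exists_eq_add_one_of_ne_zero hm
    apply le_antisymm <;> rw [Ideal.span_le, Set.pair_subset_iff] <;>
      simp only [SetLike.mem_coe, Ideal.mem_span_pair]
    · exact ⟨⟨0, 1, by ring⟩, c, X i ^ n, by ring⟩
    · exact ⟨⟨-c' * X i ^ n, c', by linear_combination X j ^ (n + 1) * hc'⟩, 1, 0, by ring⟩
  have hpair : ({X j, X i} : Set (MvPolynomial (Fin 2) k)) = {X 0, X 1} := by
    fin_cases i <;> fin_cases j <;> simp_all [Set.pair_comm]
  rw [hspan, rank_quotient_pair_pow (X_ne_zero j) (isRelPrime_X hij.symm), hpair,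
    rank_quotient_X_X, mul_one]

theorem rank_quotient_X_pow_mul_X_pow (k : Type*) [Field k]
    {c : MvPolynomial (Fin 2) k} (hc : IsUnit c) {m : ℕ} (hm : m ≠ 0) (p q : ℕ) :
    Module.rank k
      (MvPolynomial (Fin 2) k ⧸
        Ideal.span {X 0 ^ p * X 1 ^ q, (X 0 ^ m + c * X 1 ^ m : MvPolynomial (Fin 2) k)}) =
      (m * (p + q) : ℕ) := by
  obtain ⟨c', hc'⟩ := hc.exists_left_inv
  have hu : IsUnit c' := .of_mul_eq_one c hc'
  have hspan : Ideal.span {X 1, X 0 ^ m + c * X 1 ^ m} =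
      Ideal.span {X 1, X 1 ^ m + c' * X 0 ^ m} := by
    have e : X 0 ^ m + c * X 1 ^ m = (X 1 ^ m + c' * X 0 ^ m) * c := by
      linear_combination -X 0 ^ m * hc'
    rw [Ideal.span_insert, Ideal.span_insert, e, Ideal.span_singleton_mul_right_unit hc]
  have h0 := isRelPrime_X_pow_add zero_ne_one hc hm
  have h1 := isRelPrime_X_pow_add_mul_self_pow one_ne_zero c hm
  rw [rank_quotient_pair_mul (pow_ne_zero _ (X_ne_zero 0)) h0.pow_left,
    rank_quotient_pair_pow (X_ne_zero 1) h1, rank_quotient_pair_pow (X_ne_zero 0) h0, hspan,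
    rank_quotient_X_pow_add zero_ne_one hc hm,
    rank_quotient_X_pow_add one_ne_zero hu hm]
  push_cast
  ring


/-- The ideal `I_A = (x^u y^u, x^{s−v} y^{u−r} + (−1)^{u−r} x^{u−r} y^{s−v},
x^{r+s} + (−1)^r y^{r+s})` of a type `A` `G`-graph has quotient of dimension
`2(su − rv)` as a `ℂ`-vector space. -/
theorem stmt_12 (r s u v : ℕ) (hru : r < u) (huv : u ≤ v) (hvs : v < s)
    (htypeA : u < s - v) (hpar : (u - r) % 2 = (s - v) % 2)
    (I : Ideal (MvPolynomial (Fin 2) ℂ))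
    (hI : I = Ideal.span
      {X 0 ^ u * X 1 ^ u,
       X 0 ^ (s - v) * X 1 ^ (u - r) + (-1) ^ (u - r) * X 0 ^ (u - r) * X 1 ^ (s - v),
       X 0 ^ (r + s) + (-1) ^ r * X 1 ^ (r + s)}) :
    FiniteDimensional ℂ (MvPolynomial (Fin 2) ℂ ⧸ I) ∧
      Module.finrank ℂ (MvPolynomial (Fin 2) ℂ ⧸ I) = 2 * (s * u - r * v) := by
  obtain ⟨b, rfl⟩ := Nat.exists_eq_add_of_le hru.le
  obtain ⟨e, rfl⟩ : ∃ e, s = v + (b + (r + e)) := ⟨s - v - b - r, by omega⟩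
  rw [Nat.add_sub_cancel_left, Nat.add_sub_cancel_left] at hI
  have hd : r + e ≠ 0 := by omega
  have hN : r + (v + (b + (r + e))) ≠ 0 := by omega
  have hunit (n : ℕ) : IsUnit ((-1 : MvPolynomial (Fin 2) ℂ) ^ n) := isUnit_one.neg.pow n
  have hsq : ((-1 : MvPolynomial (Fin 2) ℂ) ^ b) * (-1) ^ b = 1 := by
    rw [← mul_pow, neg_one_mul, neg_neg, one_pow]
  set h : MvPolynomial (Fin 2) ℂ :=
    X 0 ^ (r + (v + (b + (r + e)))) + (-1) ^ r * X 1 ^ (r + (v + (b + (r + e)))) with hh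
  set J : Ideal (MvPolynomial (Fin 2) ℂ) :=
    Ideal.span {X 0 ^ r * X 1 ^ r, X 0 ^ (r + e) + (-1) ^ b * X 1 ^ (r + e)} with hJ
  have hhJ : h ∈ J := by
    rw [hJ, Ideal.mem_span_pair]
    refine ⟨-(-1) ^ b * X 0 ^ (v + b) * X 1 ^ e - (-1) ^ (r + b) * X 1 ^ (v + b) * X 0 ^ e,
      X 0 ^ (v + b + r) + (-1) ^ (r + b) * X 1 ^ (v + b + r), ?_⟩
    rw [hh]
    simp only [pow_add]
    linear_combination (-1) ^ r * X 1 ^ r * X 1 ^ v * X 1 ^ b * X 1 ^ r * X 1 ^ e * hsq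
  have hIJ : I = Ideal.span {X 0 ^ b * X 1 ^ b} * J ⊔ Ideal.span {h} := by
    rw [hI, hJ, Ideal.span_insert (X 0 ^ r * X 1 ^ r), Ideal.mul_sup,
      Ideal.span_singleton_mul_span_singleton, Ideal.span_singleton_mul_span_singleton,
      Ideal.span_insert, Ideal.span_insert, ← sup_assoc]
    congr 4 <;> ring
  have hcop : IsRelPrime (X 0 ^ b * X 1 ^ b) h :=
    (isRelPrime_X_pow_add zero_ne_one (hunit r) hN).pow_left.mul_left
      (isRelPrime_X_pow_add_mul_self_pow one_ne_zero _ hN).pow_left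
  have hrank : Module.rank ℂ (MvPolynomial (Fin 2) ℂ ⧸ I) =
      (2 * ((v + (b + (r + e))) * (r + b) - r * v) : ℕ) := by
    rw [hIJ, rank_quotient_mul_sup
        (mul_ne_zero (pow_ne_zero _ (X_ne_zero 0)) (pow_ne_zero _ (X_ne_zero 1)))
        (fun _ ↦ hcop.dvd_of_dvd_mul_left),
      sup_eq_left.2 ((Ideal.span_singleton_le_iff_mem _).2 hhJ), ← Ideal.span_insert,
      rank_quotient_X_pow_mul_X_pow ℂ (hunit b) hd, rank_quotient_X_pow_mul_X_pow ℂ (hunit r) hN,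
      ← Nat.cast_add]
    congr 1
    rw [show (v + (b + (r + e))) * (r + b) = r * v + (v * b + (b + (r + e)) * (r + b)) by ring,
      Nat.add_sub_cancel_left]
    ring
  exact ⟨Module.finite_of_rank_eq_nat hrank, Module.finrank_eq_of_rank_eq hrank⟩
end

section
/- Let r, u, v, s, m be integers with 0 ≤ r < u ≤ v < s, m = u − r = s − v, and u ≥ 2m. Let I be the (monomial) ideal of ℂ[x,y] generated by x^{2m}·y^{2m}, x^{s+m}, y^{s+m}, x^u·y^m, and x^m·y^u. Then the quotient ℂ[x,y]/I is a finite-dimensional ℂ-vector space of dimension 2·m·(r+s). -/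
open MvPolynomial

/-- The quotient by a monomial ideal has a basis indexed by its standard monomials: if the finite
family `e` enumerates the exponents not above any generator, then the quotient is the space of
functions on the index set. -/
theorem nonempty_quotient_span_monomial_equiv {σ K ι : Type*} [Field K] [Finite ι]
    (S : Set (σ →₀ ℕ)) (e : ι → σ →₀ ℕ) (he : Function.Injective e)
    (hS : ∀ d, d ∈ Set.range e ↔ ∀ t ∈ S, ¬ t ≤ d) :
    Nonempty ((MvPolynomial σ K ⧸ Ideal.span ((fun t => monomial t (1 : K)) '' S)) ≃ₗ[K]
      (ι → K)) := by
  classical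
  have := Fintype.ofFinite ι
  set I := Ideal.span ((fun t => monomial t (1 : K)) '' S) with hI
  let f : MvPolynomial σ K →ₗ[K] (ι → K) := LinearMap.pi fun i => lcoeff K (e i)
  have hf : ∀ p i, f p i = coeff (e i) p := fun p i => rfl
  have hker : LinearMap.ker f = I.restrictScalars K := by
    ext p
    rw [LinearMap.mem_ker, Submodule.restrictScalars_mem, hI, mem_ideal_span_monomial_image]
    constructor
    · intro h d hd
      by_contra! hcon
      obtain ⟨i, rfl⟩ := (hS d).2 hcon
      exact mem_support_iff.1 hd (by rw [← hf, h]; rfl)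
    · intro h
      ext i
      rw [hf, Pi.zero_apply]
      by_contra hne
      obtain ⟨t, ht, hle⟩ := h _ (mem_support_iff.2 hne)
      exact (hS (e i)).1 ⟨i, rfl⟩ t ht hle
  have hsurj : Function.Surjective f := by
    intro g
    refine ⟨∑ i, monomial (e i) (g i), ?_⟩
    ext j
    simp [hf, coeff_sum, coeff_monomial, he.eq_iff]
  exact ⟨(Submodule.Quotient.restrictScalarsEquiv K I).symm ≪≫ₗ
    Submodule.quotEquivOfEq _ _ hker.symm ≪≫ₗ f.quotKerEquivOfSurjective hsurj⟩

/-- The exponent vector of the monomial `x ^ a * y ^ b`. -/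
noncomputable def bivariateExponent (p : ℕ × ℕ) : Fin 2 →₀ ℕ :=
  Finsupp.single 0 p.1 + Finsupp.single 1 p.2

theorem bivariateExponent_zero (p : ℕ × ℕ) : bivariateExponent p 0 = p.1 := by
  simp [bivariateExponent]

theorem bivariateExponent_one (p : ℕ × ℕ) : bivariateExponent p 1 = p.2 := by
  simp [bivariateExponent]

theorem bivariateExponent_injective : Function.Injective bivariateExponent := by
  intro p q h
  have h0 := DFunLike.congr_fun h 0
  have h1 := DFunLike.congr_fun h 1
  simp only [bivariateExponent_zero, bivariateExponent_one] at h0 h1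
  exact Prod.ext h0 h1

theorem bivariateExponent_apply (d : Fin 2 →₀ ℕ) : bivariateExponent (d 0, d 1) = d := by
  ext i
  fin_cases i
  · exact bivariateExponent_zero _
  · exact bivariateExponent_one _

theorem bivariateExponent_le_iff (p : ℕ × ℕ) (d : Fin 2 →₀ ℕ) :
    bivariateExponent p ≤ d ↔ p.1 ≤ d 0 ∧ p.2 ≤ d 1 := by
  rw [Finsupp.le_def, Fin.forall_fin_two, bivariateExponent_zero, bivariateExponent_one]

theorem monomial_bivariateExponent {K : Type*} [CommSemiring K] (a b : ℕ) :
    monomial (bivariateExponent (a, b)) (1 : K) = X 0 ^ a * X 1 ^ b := by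
  rw [X_pow_eq_monomial, X_pow_eq_monomial, monomial_mul, one_mul, bivariateExponent]

/-- The exponents `(a, b)` of the standard monomials, cut into rectangles by the value of `a`. -/
def standardExponents (s u m : ℕ) : Finset (ℕ × ℕ) :=
  ((Finset.range m ×ˢ Finset.range (s + m) ∪ Finset.Ico m (2 * m) ×ˢ Finset.range u) ∪
    Finset.Ico (2 * m) u ×ˢ Finset.range (2 * m)) ∪ Finset.Ico u (s + m) ×ˢ Finset.range m

theorem card_standardExponents {r s u m : ℕ} (hu : u = r + m) (hus : u ≤ s)
    (hmu : 2 * m ≤ u) : (standardExponents s u m).card = 2 * m * (r + s) := by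
  rw [standardExponents, Finset.card_union_of_disjoint, Finset.card_union_of_disjoint,
    Finset.card_union_of_disjoint]
  · simp only [Finset.card_product, Finset.card_range, Nat.card_Ico]
    obtain ⟨k, rfl⟩ := Nat.exists_eq_add_of_le hmu
    obtain ⟨l, rfl⟩ := Nat.exists_eq_add_of_le hus
    obtain rfl : r = m + k := by omega
    rw [show 2 * m - m = m by omega, show 2 * m + k - 2 * m = k by omega,
      show 2 * m + k + l + m - (2 * m + k) = l + m by omega]
    ring
  all_goals
    rw [Finset.disjoint_left]
    rintro ⟨a, b⟩
    simp only [Finset.mem_union, Finset.mem_product, Finset.mem_range, Finset.mem_Ico]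
    omega

/-- The monomial ideal `I_{B.2} = (x^{2m} y^{2m}, x^{s+m}, y^{s+m}, x^u y^m, x^m y^u)`
of a type `B.2` `G`-graph (`m = u − r = s − v`, `u ≥ 2m`) has quotient of dimension
`2m(r+s)`. -/
theorem stmt_14 (r s u v m : ℕ) (hru : r < u) (huv : u ≤ v) (hvs : v < s)
    (hm1 : u = r + m) (hm2 : s = v + m) (hB2 : 2 * m ≤ u)
    (I : Ideal (MvPolynomial (Fin 2) ℂ))
    (hI : I = Ideal.span
      {X 0 ^ (2 * m) * X 1 ^ (2 * m),
       X 0 ^ (s + m),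
       X 1 ^ (s + m),
       X 0 ^ u * X 1 ^ m,
       X 0 ^ m * X 1 ^ u}) :
    FiniteDimensional ℂ (MvPolynomial (Fin 2) ℂ ⧸ I) ∧
      Module.finrank ℂ (MvPolynomial (Fin 2) ℂ ⧸ I) = 2 * m * (r + s) := by
  let S : Set (ℕ × ℕ) := {(2 * m, 2 * m), (s + m, 0), (0, s + m), (u, m), (m, u)}
  have hIS : I = Ideal.span
      ((fun t => monomial t (1 : ℂ)) '' (bivariateExponent '' S)) := by
    rw [hI]
    simp [S, Set.image_insert_eq, monomial_bivariateExponent]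
  obtain ⟨φ⟩ := nonempty_quotient_span_monomial_equiv (K := ℂ) (bivariateExponent '' S)
    (fun i : standardExponents s u m => bivariateExponent i)
    (bivariateExponent_injective.comp Subtype.val_injective) (by
      intro d
      have hmem : d ∈ Set.range (fun i : standardExponents s u m => bivariateExponent i) ↔
          (d 0, d 1) ∈ standardExponents s u m := by
        constructor
        · rintro ⟨⟨p, hp⟩, rfl⟩
          simpa only [bivariateExponent_zero, bivariateExponent_one] using hp
        · exact fun h => ⟨⟨_, h⟩, bivariateExponent_apply d⟩
      rw [hmem, Set.forall_mem_image]
      simp only [S, Set.mem_insert_iff, Set.mem_singleton_iff, forall_eq_or_imp, forall_eq,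
        bivariateExponent_le_iff, standardExponents, Finset.mem_union, Finset.mem_product,
        Finset.mem_range, Finset.mem_Ico]
      omega)
  rw [← hIS] at φ
  refine ⟨φ.symm.finiteDimensional, ?_⟩
  rw [φ.finrank_eq, Module.finrank_fintype_fun_eq_card, Fintype.card_coe,
    card_standardExponents hm1 (by omega) hB2]
end

section
/- Let q ≥ 1 and let r, s be integers with 0 ≤ r < s. Let I be the ideal of ℂ[x,y] generated by x^q + (−i)^q·y^q and x^{s−r}·y^{s−r}, where i ∈ ℂ is the imaginary unit (and the same holds for the generator x^q − (−i)^q·y^q). Then the quotient ℂ[x,y]/I is a finite-dimensional ℂ-vector space of dimension 2·q·(s−r). -/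
open MvPolynomial

section QuotientRank

variable {K P : Type*} [Field K] [CommRing P] [Algebra K P]

/-- If `g` is a nonzerodivisor modulo `f`, the dimension of `P ⧸ (f, g * k)` is the sum of the
dimensions of `P ⧸ (f, g)` and `P ⧸ (f, k)`. -/
theorem rank_quotient_span_pair_mul {f g : P} (k : P) (h : ∀ p, f ∣ g * p → f ∣ p) :
    Module.rank K (P ⧸ Ideal.span {f, g * k}) =
      Module.rank K (P ⧸ Ideal.span {f, g}) + Module.rank K (P ⧸ Ideal.span {f, k}) := by
  have hφ : Ideal.span {f, k} ≤
      Submodule.comap (LinearMap.mulLeft P g) (Ideal.span {f, g * k}) := by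
    intro p hp
    obtain ⟨a, b, rfl⟩ := Ideal.mem_span_pair.1 hp
    exact Ideal.mem_span_pair.2 ⟨g * a, b, by simp only [LinearMap.mulLeft_apply]; ring⟩
  have hψ : Ideal.span {f, g * k} ≤ Submodule.comap LinearMap.id (Ideal.span {f, g}) := by
    intro p hp
    obtain ⟨a, b, rfl⟩ := Ideal.mem_span_pair.1 hp
    exact Ideal.mem_span_pair.2 ⟨a, b * k, by ring⟩
  let φ := (Submodule.mapQ _ _ _ hφ).restrictScalars K
  let ψ := (Submodule.mapQ _ _ _ hψ).restrictScalars K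
  have hφ_inj : Function.Injective φ := by
    rw [← LinearMap.ker_eq_bot, LinearMap.ker_eq_bot']
    intro z hz
    obtain ⟨p, rfl⟩ := Submodule.Quotient.mk_surjective _ z
    replace hz : g * p ∈ Ideal.span {f, g * k} := (Submodule.Quotient.mk_eq_zero _).1 hz
    obtain ⟨a, b, hab⟩ := Ideal.mem_span_pair.1 hz
    obtain ⟨c, hc⟩ := h (p - b * k) ⟨a, by linear_combination -hab⟩
    exact (Submodule.Quotient.mk_eq_zero _).2
      (Ideal.mem_span_pair.2 ⟨c, b, by linear_combination -hc⟩)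
  have hψ_surj : Function.Surjective ψ := by
    intro z
    obtain ⟨p, rfl⟩ := Submodule.Quotient.mk_surjective _ z
    exact ⟨Submodule.Quotient.mk p, rfl⟩
  have hexact : LinearMap.ker ψ = LinearMap.range φ := by
    ext z
    obtain ⟨p, rfl⟩ := Submodule.Quotient.mk_surjective _ z
    constructor
    · intro hz
      replace hz : p ∈ Ideal.span {f, g} := (Submodule.Quotient.mk_eq_zero _).1 hz
      obtain ⟨a, b, rfl⟩ := Ideal.mem_span_pair.1 hz
      refine ⟨Submodule.Quotient.mk b, (Submodule.Quotient.eq _).2 ?_⟩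
      exact Ideal.mem_span_pair.2 ⟨-a, 0, by simp only [LinearMap.mulLeft_apply]; ring⟩
    · rintro ⟨w, hw⟩
      obtain ⟨b, rfl⟩ := Submodule.Quotient.mk_surjective _ w
      rw [← hw]
      exact (Submodule.Quotient.mk_eq_zero _).2
        (Ideal.mem_span_pair.2
          ⟨0, b, by simp only [LinearMap.mulLeft_apply, LinearMap.id_apply]; ring⟩)
  rw [← LinearMap.rank_range_add_rank_ker ψ, hexact, rank_range_of_surjective ψ hψ_surj,
    rank_range_of_injective φ hφ_inj]

theorem rank_quotient_span_pair_pow {f g : P} (h : ∀ p, f ∣ g * p → f ∣ p) (n : ℕ) :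
    Module.rank K (P ⧸ Ideal.span {f, g ^ n}) = n * Module.rank K (P ⧸ Ideal.span {f, g}) := by
  induction n with
  | zero =>
    have : Ideal.span {f, g ^ 0} = ⊤ :=
      (Ideal.eq_top_iff_one _).2 (Ideal.subset_span (by simp))
    rw [this, Nat.cast_zero, zero_mul]
    exact rank_subsingleton' _ _
  | succ n ih =>
    rw [pow_succ', rank_quotient_span_pair_mul _ h, ih, Nat.cast_succ, add_mul, one_mul, add_comm]

end QuotientRank

theorem Prime.dvd_of_dvd_mul_of_not_dvd {P : Type*} [CommRing P] [IsDomain P] {f g p : P}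
    (hg : Prime g) (hf : ¬ g ∣ f) (h : f ∣ g * p) : f ∣ p := by
  obtain ⟨u, hu⟩ := h
  obtain ⟨v, rfl⟩ := (hg.dvd_or_dvd ⟨p, hu.symm⟩).resolve_left hf
  exact ⟨v, mul_left_cancel₀ hg.ne_zero (by linear_combination hu)⟩

theorem rank_quotient_span_X_zero_X_one (K : Type*) [Field K] :
    Module.rank K (MvPolynomial (Fin 2) K ⧸
      Ideal.span {(X 0 : MvPolynomial (Fin 2) K), X 1}) = 1 := by
  have hspan : Ideal.span {(X 0 : MvPolynomial (Fin 2) K), X 1} =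
      RingHom.ker (aeval (R := K) (fun _ : Fin 2 => (0 : K))) := by
    have : ({X 0, X 1} : Set (MvPolynomial (Fin 2) K)) = Set.range X := by
      ext; simp [Fin.exists_fin_two, eq_comm]
    ext p
    rw [this, ← pow_one (Ideal.span _), mem_pow_idealOfVars_iff']
    simp [RingHom.mem_ker, Finsupp.degree_eq_zero_iff, constantCoeff_eq]
  have hsurj : Function.Surjective (aeval (R := K) (fun _ : Fin 2 => (0 : K))) :=
    fun a => ⟨C a, by simp⟩
  rw [hspan, (Ideal.quotientKerAlgEquivOfSurjective hsurj).toLinearEquiv.rank_eq, Module.rank_self]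

theorem rank_quotient_span_X_pow_add_C_mul_X_pow {K : Type*} [Field K] {q : ℕ} (hq : q ≠ 0)
    {c : K} (hc : c ≠ 0) (m : ℕ) :
    Module.rank K (MvPolynomial (Fin 2) K ⧸ Ideal.span
      {(X 0 ^ q + C c * X 1 ^ q : MvPolynomial (Fin 2) K), X 0 ^ m * X 1 ^ m}) =
      (2 * q * m : ℕ) := by
  have h0 : Prime (X 0 : MvPolynomial (Fin 2) K) := X_prime
  have h1 : Prime (X 1 : MvPolynomial (Fin 2) K) := X_prime
  have hcu : IsUnit (C c : MvPolynomial (Fin 2) K) := (IsUnit.mk0 c hc).map C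
  have hd0 : ¬ (X 0 : MvPolynomial (Fin 2) K) ∣ X 0 ^ q + C c * X 1 ^ q := by
    rw [dvd_add_right (dvd_pow_self _ hq), hcu.dvd_mul_left]
    exact fun h => by simpa [X_dvd_X] using h0.dvd_of_dvd_pow h
  have hd1 : ¬ (X 1 : MvPolynomial (Fin 2) K) ∣ X 0 ^ q + C c * X 1 ^ q := by
    rw [dvd_add_left ((dvd_pow_self _ hq).mul_left _)]
    exact fun h => by simpa [X_dvd_X] using h1.dvd_of_dvd_pow h
  have hc0 := fun p => h0.dvd_of_dvd_mul_of_not_dvd (p := p) hd0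
  have hc1 := fun p => h1.dvd_of_dvd_mul_of_not_dvd (p := p) hd1
  have hc0_pow : ∀ n p, (X 0 ^ q + C c * X 1 ^ q : MvPolynomial (Fin 2) K) ∣ X 0 ^ n * p →
      (X 0 ^ q + C c * X 1 ^ q : MvPolynomial (Fin 2) K) ∣ p := by
    intro n
    induction n with
    | zero => simp
    | succ n ih => exact fun p hp => ih p (hc0 _ (by rwa [← mul_assoc, ← pow_succ']))
  have hs0 : Ideal.span {(X 0 ^ q + C c * X 1 ^ q : MvPolynomial (Fin 2) K), X 0} =
      Ideal.span {X 0, X 1 ^ q} := by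
    obtain ⟨d, hd⟩ := hcu.exists_left_inv
    obtain ⟨n, rfl⟩ := Nat.exists_eq_add_one_of_ne_zero hq
    apply le_antisymm <;> rw [Ideal.span_le, Set.insert_subset_iff, Set.singleton_subset_iff]
    · exact ⟨Ideal.mem_span_pair.2 ⟨X 0 ^ n, C c, by ring⟩, Ideal.subset_span (by simp)⟩
    · refine ⟨Ideal.subset_span (by simp), Ideal.mem_span_pair.2 ⟨d, -d * X 0 ^ n, ?_⟩⟩
      linear_combination X 1 ^ (n + 1) * hd
  have hs1 : Ideal.span {(X 0 ^ q + C c * X 1 ^ q : MvPolynomial (Fin 2) K), X 1} =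
      Ideal.span {X 1, X 0 ^ q} := by
    obtain ⟨n, rfl⟩ := Nat.exists_eq_add_one_of_ne_zero hq
    apply le_antisymm <;> rw [Ideal.span_le, Set.insert_subset_iff, Set.singleton_subset_iff]
    · exact ⟨Ideal.mem_span_pair.2 ⟨C c * X 1 ^ n, 1, by ring⟩, Ideal.subset_span (by simp)⟩
    · exact ⟨Ideal.subset_span (by simp), Ideal.mem_span_pair.2 ⟨1, -C c * X 1 ^ n, by ring⟩⟩
  have hx : ∀ p, (X 0 : MvPolynomial (Fin 2) K) ∣ X 1 * p → X 0 ∣ p :=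
    fun p => h1.dvd_of_dvd_mul_of_not_dvd (by simp [X_dvd_X])
  have hy : ∀ p, (X 1 : MvPolynomial (Fin 2) K) ∣ X 0 * p → X 1 ∣ p :=
    fun p => h0.dvd_of_dvd_mul_of_not_dvd (by simp [X_dvd_X])
  rw [rank_quotient_span_pair_mul _ (hc0_pow m), rank_quotient_span_pair_pow hc0,
    rank_quotient_span_pair_pow hc1, hs0, hs1, rank_quotient_span_pair_pow hx,
    rank_quotient_span_pair_pow hy, Set.pair_comm (X 1) (X 0), rank_quotient_span_X_zero_X_one]
  push_cast
  ring

/-- The ideals `I_{D^±} = (x^q ± (−i)^q y^q, x^{s−r} y^{s−r})` of the type `D^±`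
`G`-graphs have quotient of dimension `2q(s−r)` as a `ℂ`-vector space. -/
theorem stmt_15 (q : ℕ) (hq : 1 ≤ q) (r s : ℕ) (hrs : r < s)
    (c : ℂ) (hc : c = (-Complex.I) ^ q ∨ c = -((-Complex.I) ^ q))
    (I : Ideal (MvPolynomial (Fin 2) ℂ))
    (hI : I = Ideal.span
      {X 0 ^ q + C c * X 1 ^ q,
       X 0 ^ (s - r) * X 1 ^ (s - r)}) :
    FiniteDimensional ℂ (MvPolynomial (Fin 2) ℂ ⧸ I) ∧
      Module.finrank ℂ (MvPolynomial (Fin 2) ℂ ⧸ I) = 2 * q * (s - r) := by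
  have hc_ne : c ≠ 0 := by rcases hc with rfl | rfl <;> simp
  have hrank := rank_quotient_span_X_pow_add_C_mul_X_pow (by omega : q ≠ 0) hc_ne (s - r)
  rw [← hI] at hrank
  exact ⟨Module.rank_lt_aleph0_iff.1 (hrank ▸ Cardinal.natCast_lt_aleph0),
    Module.finrank_eq_of_rank_eq hrank⟩
end

section
/- Let q > m ≥ 1 be integers and set s = q + m. Let I be the ideal of ℂ[x,y] generated by y^m·(x^q + (−i)^q·y^q), x^m·(x^q + (−i)^q·y^q), x^{2m}·y^{2m}, x^s·y^m, and x^m·y^s, where i ∈ ℂ is the imaginary unit (and the same holds with (−i)^q replaced by −(−i)^q). Then the quotient ℂ[x,y]/I is a finite-dimensional ℂ-vector space of dimension 4·q·m. -/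
open MvPolynomial

namespace BinaryDihedral

/-- The number of standard monomials `x ^ i * y ^ j` with given exponent `i < q + m`. -/
def columnHeight (q m i : ℕ) : ℕ :=
  if i + q < 2 * m then 2 * q + m
  else if i < m then q + 2 * m
  else if i < 2 * m ∧ i < q then q + m
  else if i < q then 2 * m
  else m

/-- The exponents `(i, j)` of the standard monomials `x ^ i * y ^ j`. -/
abbrev StandardIndex (q m : ℕ) : Type :=
  Σ i : Fin (q + m), Fin (columnHeight q m i)

theorem card_standardIndex {q m : ℕ} (hq : m < q) :
    Fintype.card (StandardIndex q m) = 4 * q * m := by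
  simp only [Fintype.card_sigma, Fintype.card_fin]
  rw [Fin.sum_univ_eq_sum_range (columnHeight q m)]
  have sum_const (a n k : ℕ) (h : ∀ i < n, columnHeight q m (a + i) = k) :
      ∑ i ∈ Finset.range n, columnHeight q m (a + i) = n * k := by
    rw [Finset.sum_congr rfl fun i hi => h i (Finset.mem_range.1 hi)]
    simp
  rcases le_or_gt (2 * m) q with h | h
  · obtain ⟨t, rfl⟩ := Nat.exists_eq_add_of_le h
    rw [show 2 * m + t + m = 0 + m + m + t + m by ring, Finset.sum_range_add,
      Finset.sum_range_add, Finset.sum_range_add, Finset.sum_range_add,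
      sum_const 0 m (2 * m + t + 2 * m), sum_const _ m (2 * m + t + m),
      sum_const _ t (2 * m), sum_const _ m m]
    · simp only [Finset.range_zero, Finset.sum_empty]
      ring
    all_goals
      intro i hi
      unfold columnHeight
      split_ifs <;> omega
  · obtain ⟨t, rfl⟩ := Nat.exists_eq_add_of_le hq.le
    obtain ⟨u, rfl⟩ := Nat.exists_eq_add_of_le (show t ≤ m by omega)
    rw [show t + u + t + (t + u) = 0 + u + t + t + (t + u) by ring, Finset.sum_range_add,
      Finset.sum_range_add, Finset.sum_range_add, Finset.sum_range_add,
      sum_const 0 u (2 * (t + u + t) + (t + u)), sum_const _ t (t + u + t + 2 * (t + u)),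
      sum_const _ t (t + u + t + (t + u)), sum_const _ (t + u) (t + u)]
    · simp only [Finset.range_zero, Finset.sum_empty]
      ring
    all_goals
      intro i hi
      unfold columnHeight
      split_ifs <;> omega

/-- The coordinates of the normal form of `x ^ i * y ^ j`, obtained by rewriting
`x ^ i * y ^ j` to `-c * x ^ (i - q) * y ^ (j + q)` as long as the generators
`y ^ m * (x ^ q + c * y ^ q)` and `x ^ m * (x ^ q + c * y ^ q)` allow it. -/
noncomputable def normalForm (q m : ℕ) (c : ℂ) (i j : ℕ) : StandardIndex q m → ℂ :=
  if 0 < q ∧ q ≤ i ∧ (m ≤ j ∨ q + m ≤ i) then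
    (-c) • normalForm q m c (i - q) (j + q)
  else if h : ∃ _ : i < q + m, j < columnHeight q m i then
    Pi.single ⟨⟨i, h.1⟩, ⟨j, h.2⟩⟩ 1
  else 0
termination_by i

theorem normalForm_of_reducible {q m : ℕ} {i j : ℕ} (c : ℂ) (hq : 0 < q) (hi : q ≤ i)
    (h : m ≤ j ∨ q + m ≤ i) :
    normalForm q m c i j = (-c) • normalForm q m c (i - q) (j + q) := by
  rw [normalForm, if_pos ⟨hq, hi, h⟩]

theorem normalForm_standard {q m : ℕ} (c : ℂ) (hq : m < q) (p : StandardIndex q m) :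
    normalForm q m c p.1 p.2 = Pi.single p 1 := by
  obtain ⟨⟨i, hi⟩, ⟨j, hj⟩⟩ := p
  have hj' := hj
  dsimp only at hj' ⊢
  rw [normalForm, if_neg, dif_pos ⟨hi, hj⟩]
  unfold columnHeight at hj'
  split_ifs at hj' <;> omega

/-- Explicit description of (a set containing) the exponents of the monomials in the ideal. -/
def Vanishing (q m i j : ℕ) : Prop :=
  (m ≤ i ∧ q + m ≤ j) ∨ (2 * m ≤ i ∧ 2 * m ≤ j) ∨ (2 * m ≤ i + q ∧ q + 2 * m ≤ j) ∨
    2 * q + m ≤ j ∨ (q + m ≤ i ∧ m ≤ j)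

theorem normalForm_eq_zero {q m : ℕ} (c : ℂ) (hm : 0 < m) (hq : m < q) (i j : ℕ)
    (h : Vanishing q m i j) : normalForm q m c i j = 0 := by
  induction i using Nat.strong_induction_on generalizing j with
  | _ i ih =>
    rw [normalForm]
    unfold Vanishing at h ih
    split_ifs with h₁ h₂
    · rw [ih (i - q) (by omega) (j + q) (by omega), smul_zero]
    · obtain ⟨hi, hj⟩ := h₂
      unfold columnHeight at hj
      split_ifs at hj <;> omega
    · rfl

theorem linearMap_ext {V : Type*} [AddCommMonoid V] [Module ℂ V]
    {f g : MvPolynomial (Fin 2) ℂ →ₗ[ℂ] V}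
    (h : ∀ i j : ℕ, f (X 0 ^ i * X 1 ^ j) = g (X 0 ^ i * X 1 ^ j)) : f = g := by
  refine (basisMonomials (Fin 2) ℂ).ext fun d => ?_
  have : monomial d (1 : ℂ) = X 0 ^ d 0 * X 1 ^ d 1 := by
    rw [monomial_eq, Finsupp.prod_fintype _ _ (by simp)]
    simp
  simp only [coe_basisMonomials, this, h]

/-- The linear map sending a polynomial to the coordinates of its normal form. -/
noncomputable def normalFormMap (q m : ℕ) (c : ℂ) :
    MvPolynomial (Fin 2) ℂ →ₗ[ℂ] (StandardIndex q m → ℂ) :=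
  (basisMonomials (Fin 2) ℂ).constr ℂ fun d => normalForm q m c (d 0) (d 1)

theorem normalFormMap_monomial (q m : ℕ) (c : ℂ) (i j : ℕ) :
    normalFormMap q m c (X 0 ^ i * X 1 ^ j) = normalForm q m c i j := by
  have : (X 0 ^ i * X 1 ^ j : MvPolynomial (Fin 2) ℂ) =
      basisMonomials (Fin 2) ℂ (Finsupp.single 0 i + Finsupp.single 1 j) := by
    simp [X_pow_eq_monomial, monomial_mul]
  rw [this, normalFormMap, Module.Basis.constr_basis]
  simp

theorem normalFormMap_eq_zero_of_mem_span {q m : ℕ} {c : ℂ}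
    {S : Set (MvPolynomial (Fin 2) ℂ)}
    (hS : ∀ g ∈ S, ∀ i j : ℕ, normalFormMap q m c (X 0 ^ i * X 1 ^ j * g) = 0)
    {p : MvPolynomial (Fin 2) ℂ} (hp : p ∈ Ideal.span S) : normalFormMap q m c p = 0 := by
  suffices ∀ r, normalFormMap q m c (r * p) = 0 by simpa using this 1
  induction hp using Submodule.span_induction with
  | mem g hg =>
    intro r
    have : normalFormMap q m c ∘ₗ LinearMap.mulRight ℂ g = 0 :=
      linearMap_ext fun i j => by simpa using hS g hg i j
    simpa using LinearMap.congr_fun this r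
  | zero => simp
  | add a b _ _ ha hb => intro r; rw [mul_add, map_add, ha, hb, add_zero]
  | smul a b _ hb => intro r; rw [smul_eq_mul, ← mul_assoc, hb]

/-- The ideal `(y^m (x^q + c y^q), x^m (x^q + c y^q), x^{2m} y^{2m}, x^{q+m} y^m, x^m y^{q+m})`. -/
noncomputable def graphIdeal (q m : ℕ) (c : ℂ) : Ideal (MvPolynomial (Fin 2) ℂ) :=
  Ideal.span
    {X 1 ^ m * (X 0 ^ q + C c * X 1 ^ q),
     X 0 ^ m * (X 0 ^ q + C c * X 1 ^ q),
     X 0 ^ (2 * m) * X 1 ^ (2 * m),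
     X 0 ^ (q + m) * X 1 ^ m,
     X 0 ^ m * X 1 ^ (q + m)}

theorem normalFormMap_eq_zero_of_mem {q m : ℕ} {c : ℂ} (hm : 0 < m) (hq : m < q)
    {p : MvPolynomial (Fin 2) ℂ} (hp : p ∈ graphIdeal q m c) : normalFormMap q m c p = 0 := by
  have mono (i j a b : ℕ) (h : Vanishing q m (i + a) (j + b)) :
      normalFormMap q m c (X 0 ^ i * X 1 ^ j * (X 0 ^ a * X 1 ^ b)) = 0 := by
    rw [show (X 0 ^ i * X 1 ^ j * (X 0 ^ a * X 1 ^ b) : MvPolynomial (Fin 2) ℂ) =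
      X 0 ^ (i + a) * X 1 ^ (j + b) by ring, normalFormMap_monomial,
      normalForm_eq_zero c hm hq _ _ h]
  have binom (i j a b : ℕ) (h : m ≤ j + b ∨ m ≤ i + a) :
      normalFormMap q m c (X 0 ^ i * X 1 ^ j * (X 0 ^ a * X 1 ^ b *
        (X 0 ^ q + C c * X 1 ^ q))) = 0 := by
    rw [show (X 0 ^ i * X 1 ^ j * (X 0 ^ a * X 1 ^ b * (X 0 ^ q + C c * X 1 ^ q)) :
      MvPolynomial (Fin 2) ℂ) = X 0 ^ (i + a + q) * X 1 ^ (j + b) +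
        C c * (X 0 ^ (i + a) * X 1 ^ (j + b + q)) by ring, ← smul_eq_C_mul, map_add, map_smul,
      normalFormMap_monomial, normalFormMap_monomial,
      normalForm_of_reducible c (by omega) (by omega) (by omega), Nat.add_sub_cancel]
    simp
  refine normalFormMap_eq_zero_of_mem_span (fun g hg i j => ?_) hp
  simp only [Set.mem_insert_iff, Set.mem_singleton_iff] at hg
  rcases hg with rfl | rfl | rfl | rfl | rfl
  · simpa using binom i j 0 m (by omega)
  · simpa using binom i j m 0 (by omega)
  all_goals
    apply mono
    unfold Vanishing
    omega

theorem X_pow_mul_X_pow_mem {I : Ideal (MvPolynomial (Fin 2) ℂ)} {a b i j : ℕ}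
    (h : X 0 ^ a * X 1 ^ b ∈ I) (hi : a ≤ i) (hj : b ≤ j) : X 0 ^ i * X 1 ^ j ∈ I :=
  I.mem_of_dvd (mul_dvd_mul (pow_dvd_pow _ hi) (pow_dvd_pow _ hj)) h

theorem binomial_mem_graphIdeal {q m : ℕ} (c : ℂ) (i j : ℕ) (h : m ≤ j ∨ m ≤ i) :
    X 0 ^ (i + q) * X 1 ^ j + C c * (X 0 ^ i * X 1 ^ (j + q)) ∈ graphIdeal q m c := by
  rw [show (X 0 ^ (i + q) * X 1 ^ j + C c * (X 0 ^ i * X 1 ^ (j + q)) :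
    MvPolynomial (Fin 2) ℂ) = X 0 ^ i * X 1 ^ j * (X 0 ^ q + C c * X 1 ^ q) by ring]
  rcases h with h | h
  · refine Ideal.mem_of_dvd _ (mul_dvd_mul_right ((pow_dvd_pow _ h).mul_left _) _)
      (Ideal.subset_span ?_)
    simp
  · refine Ideal.mem_of_dvd _ (mul_dvd_mul_right ((pow_dvd_pow _ h).mul_right _) _)
      (Ideal.subset_span ?_)
    simp

theorem X_pow_mul_X_pow_mem_graphIdeal {q m : ℕ} {c : ℂ} (hc : c ≠ 0) (hq : m < q) (i j : ℕ)
    (h : Vanishing q m i j) : X 0 ^ i * X 1 ^ j ∈ graphIdeal q m c := by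
  have corner₁ : X 0 ^ m * X 1 ^ (q + m) ∈ graphIdeal q m c := Ideal.subset_span (by simp)
  have corner₂ : X 0 ^ (2 * m) * X 1 ^ (2 * m) ∈ graphIdeal q m c :=
    Ideal.subset_span (by simp)
  have corner₃ : X 0 ^ (q + m) * X 1 ^ m ∈ graphIdeal q m c := Ideal.subset_span (by simp)
  have shift (j : ℕ) (hj : m ≤ j) (h : X 0 ^ (i + q) * X 1 ^ j ∈ graphIdeal q m c) :
      X 0 ^ i * X 1 ^ (j + q) ∈ graphIdeal q m c := by
    have := (Submodule.add_mem_iff_right _ h).1 (binomial_mem_graphIdeal c i j (Or.inl hj))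
    have := (graphIdeal q m c).mul_mem_left (C c⁻¹) this
    rwa [← mul_assoc, ← C_mul, inv_mul_cancel₀ hc, C_1, one_mul] at this
  rcases h with h | h | h | h | h
  · exact X_pow_mul_X_pow_mem corner₁ h.1 h.2
  · exact X_pow_mul_X_pow_mem corner₂ h.1 h.2
  · rw [← Nat.sub_add_cancel (show q ≤ j by omega)]
    exact shift _ (by omega) (X_pow_mul_X_pow_mem corner₂ (by omega) (by omega))
  · rw [← Nat.sub_add_cancel (show q ≤ j by omega)]
    exact shift _ (by omega) (X_pow_mul_X_pow_mem corner₁ (by omega) (by omega))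
  · exact X_pow_mul_X_pow_mem corner₃ h.1 h.2

/-- The linear combination of standard monomials with given coordinates, modulo the ideal. -/
noncomputable def ofCoordinates (q m : ℕ) (c : ℂ) :
    (StandardIndex q m → ℂ) →ₗ[ℂ] MvPolynomial (Fin 2) ℂ ⧸ graphIdeal q m c :=
  Fintype.linearCombination ℂ fun p =>
    Ideal.Quotient.mkₐ ℂ (graphIdeal q m c) (X 0 ^ (p.1 : ℕ) * X 1 ^ (p.2 : ℕ))

theorem ofCoordinates_normalForm {q m : ℕ} {c : ℂ} (hc : c ≠ 0) (hq : m < q) (i j : ℕ) :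
    ofCoordinates q m c (normalForm q m c i j) =
      Ideal.Quotient.mkₐ ℂ (graphIdeal q m c) (X 0 ^ i * X 1 ^ j) := by
  induction i using Nat.strong_induction_on generalizing j with
  | _ i ih =>
    rw [normalForm]
    split_ifs with h₁ h₂
    · obtain ⟨k, rfl⟩ := Nat.exists_eq_add_of_le' h₁.2.1
      rw [map_smul, Nat.add_sub_cancel, ih k (by omega), ← map_smul, eq_comm]
      refine Ideal.Quotient.eq.2 ?_
      have := binomial_mem_graphIdeal (q := q) (m := m) c k j (by omega)
      rwa [neg_smul, sub_neg_eq_add, smul_eq_C_mul]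
    · simp [ofCoordinates, Fintype.linearCombination_apply_single]
    · rw [map_zero, eq_comm]
      refine Ideal.Quotient.eq_zero_iff_mem.2 (X_pow_mul_X_pow_mem_graphIdeal hc hq i j ?_)
      unfold columnHeight at h₂
      unfold Vanishing
      simp only [exists_prop] at h₂
      split_ifs at h₂ <;> omega

/-- The standard monomials form a basis of the quotient by the ideal. -/
noncomputable def quotientEquiv {q m : ℕ} {c : ℂ} (hc : c ≠ 0) (hm : 0 < m) (hq : m < q) :
    (MvPolynomial (Fin 2) ℂ ⧸ graphIdeal q m c) ≃ₗ[ℂ] (StandardIndex q m → ℂ) :=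
  LinearEquiv.ofLinearMap
    (((graphIdeal q m c).restrictScalars ℂ).liftQ (normalFormMap q m c)
      fun _ hp => normalFormMap_eq_zero_of_mem hm hq
        ((Submodule.restrictScalars_mem _ _ _).1 hp))
    (ofCoordinates q m c)
    (by
      refine (Pi.basisFun ℂ _).ext fun p => ?_
      have := Fintype.linearCombination_apply_single ℂ (fun p : StandardIndex q m =>
        Ideal.Quotient.mkₐ ℂ (graphIdeal q m c) (X 0 ^ (p.1 : ℕ) * X 1 ^ (p.2 : ℕ))) p 1
      rw [one_smul] at this
      rw [Pi.basisFun_apply]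
      refine (congrArg _ this).trans ?_
      exact (normalFormMap_monomial q m c _ _).trans (normalForm_standard c hq p))
    (by
      have key : ofCoordinates q m c ∘ₗ normalFormMap q m c =
          (Ideal.Quotient.mkₐ ℂ (graphIdeal q m c)).toLinearMap :=
        linearMap_ext fun i j => by
          rw [LinearMap.comp_apply, normalFormMap_monomial, ofCoordinates_normalForm hc hq]
          rfl
      refine LinearMap.ext fun x => ?_
      obtain ⟨p, rfl⟩ := Ideal.Quotient.mk_surjective x
      exact LinearMap.congr_fun key p)

end BinaryDihedral

open BinaryDihedral in
/-- The ideals `I_{C^±_B} = (y^m(x^q ± (−i)^q y^q), x^m(x^q ± (−i)^q y^q),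
x^{2m} y^{2m}, x^s y^m, x^m y^s)` with `s = q + m` have quotient of dimension `4qm`. -/
theorem stmt_16 (q m s : ℕ) (hm : 1 ≤ m) (hq : m < q) (hs : s = q + m)
    (c : ℂ) (hc : c = (-Complex.I) ^ q ∨ c = -((-Complex.I) ^ q))
    (I : Ideal (MvPolynomial (Fin 2) ℂ))
    (hI : I = Ideal.span
      {X 1 ^ m * (X 0 ^ q + C c * X 1 ^ q),
       X 0 ^ m * (X 0 ^ q + C c * X 1 ^ q),
       X 0 ^ (2 * m) * X 1 ^ (2 * m),
       X 0 ^ s * X 1 ^ m,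
       X 0 ^ m * X 1 ^ s}) :
    FiniteDimensional ℂ (MvPolynomial (Fin 2) ℂ ⧸ I) ∧
      Module.finrank ℂ (MvPolynomial (Fin 2) ℂ ⧸ I) = 4 * q * m := by
  have hc₀ : c ≠ 0 := by
    rcases hc with rfl | rfl <;> simp
  have e := quotientEquiv hc₀ hm hq
  obtain rfl : I = graphIdeal q m c := by rw [hI, hs, graphIdeal]
  refine ⟨e.symm.finiteDimensional, ?_⟩
  rw [e.finrank_eq, Module.finrank_fintype_fun_eq_card, card_standardIndex hq]
end
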